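/- arXiv:2004.10526 — 6 statements merged into one kernel-verified Lean document; each statement's English description precedes it below -/
import Mathlib

section
/- For any prime p > 3, the following congruence of rational numbers holds: Σ_{k=0}^{p-1} (3k-1) · ((1/2)_k · (-1/2)_k^2 / (k!)^3) · 4^k ≡ p - 2p^3 (mod p^4), i.e., the difference of the two sides is a rational number whose numerator (in lowest terms) is divisible by p^4 and whose denominator is coprime to p. -/
open Finset

/-- The Pochhammer symbol (rising factorial) `(a)_k = a(a+1)⋯(a+k-1)` for rationals. -/
def risingRat (a : ℚ) (k : ℕ) : ℚ := ∏ i ∈ Finset.range k, (a + i)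

/-- The `k`-th weight of a cubic (Rahman type) hypergeometric series. -/
def cubicWeight (a b c e : ℚ) (k : ℕ) : ℚ :=
  ∏ j ∈ range k, (a + j) * (b + 2 * j) * (c + 2 * j) * (e + 2 * j) /
    (2 * (j + 1) * (1 + a - b + j) * (1 + a - c + j) * (1 + a - e + j))

/-- The truncated cubic hypergeometric series. -/
def cubicSum (a b c e : ℚ) (K : ℕ) : ℚ :=
  ∑ k ∈ range K, (3 * (k : ℚ) + a) * cubicWeight a b c e k

theorem cubicWeight_succ (a b c e : ℚ) (k : ℕ) :
    cubicWeight a b c e (k + 1) = cubicWeight a b c e k *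
      ((a + k) * (b + 2 * k) * (c + 2 * k) * (e + 2 * k) /
        (2 * (k + 1) * (1 + a - b + k) * (1 + a - c + k) * (1 + a - e + k))) :=
  prod_range_succ _ _

theorem cubicSum_succ (a b c e : ℚ) (K : ℕ) :
    cubicSum a b c e (K + 1) =
      cubicSum a b c e K + (3 * (K : ℚ) + a) * cubicWeight a b c e K :=
  sum_range_succ _ _

theorem cubicWeight_shift {a b c e : ℚ} {K : ℕ} (hab : a - b ≠ 0)
    (hb : ∀ j < K, 1 + a - b + (j : ℚ) ≠ 0) (hc : ∀ j < K, 1 + a - c + (j : ℚ) ≠ 0)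
    (he : ∀ j < K, 1 + a - e + (j : ℚ) ≠ 0) {k : ℕ} (hk : k < K) :
    a * (a - b) * b * cubicWeight (a + 1) (b + 2) c e k =
      (1 + a - c) * (1 + a - e) * ((a + k) * (b + 2 * k) * (a - b + k)) *
        cubicWeight a b c e k / ((1 + a - c + k) * (1 + a - e + k)) := by
  induction k with
  | zero =>
    have h2 := hc 0 hk
    have h3 := he 0 hk
    simp only [Nat.cast_zero, add_zero] at h2 h3
    simp only [cubicWeight, range_zero, prod_empty, Nat.cast_zero, add_zero]
    field_simp
    ring
  | succ k ih =>
    have ih := ih (by omega)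
    have h1 := hb k (by omega)
    have h2 := hc k (by omega)
    have h3 := he k (by omega)
    have h4 : a - b + (k : ℚ) ≠ 0 := by
      rcases k with _ | k
      · simpa using hab
      · have := hb k (by omega)
        push_cast
        intro h
        exact this (by linarith)
    have h5 : (k : ℚ) + 1 ≠ 0 := by positivity
    have h6 : 1 + (a + 1) - (b + 2) + (k : ℚ) = a - b + k := by ring
    have h7 := hc (k + 1) hk
    have h8 := he (k + 1) hk
    push_cast at h7 h8
    have e7 : 1 + (a + 1) - c + (k : ℚ) = 1 + a - c + ((k : ℚ) + 1) := by ring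
    have e8 : 1 + (a + 1) - e + (k : ℚ) = 1 + a - e + ((k : ℚ) + 1) := by ring
    rw [cubicWeight_succ, cubicWeight_succ, ← mul_assoc, ih, h6, e7, e8]
    push_cast
    field_simp
    ring

theorem cubicSum_shift_add {a b c e : ℚ} {K : ℕ} (hsum : b + c + e = 2 * a + 1)
    (hab : a - b ≠ 0) (hb : ∀ j < K, 1 + a - b + (j : ℚ) ≠ 0)
    (hc : ∀ j < K, 1 + a - c + (j : ℚ) ≠ 0) (he : ∀ j < K, 1 + a - e + (j : ℚ) ≠ 0)
    {n : ℕ} (hn : n ≤ K) :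
    a * (a - b) * b * cubicSum (a + 1) (b + 2) c e n +
        b * (1 + a - c) * (1 + a - e) * cubicSum a b c e n =
      2 * (1 + a - c) * (1 + a - e) * (n * (a - b + n)) * cubicWeight a b c e n := by
  induction n with
  | zero => simp [cubicSum]
  | succ n ih =>
    have ih := ih (by omega)
    have hw := cubicWeight_shift hab hb hc he (k := n) (by omega)
    have h1 := hb n (by omega)
    have h2 := hc n (by omega)
    have h3 := he n (by omega)
    have h5 : (n : ℚ) + 1 ≠ 0 := by positivity
    rw [cubicSum_succ, cubicSum_succ, cubicWeight_succ]
    calc _ = (a * (a - b) * b * cubicSum (a + 1) (b + 2) c e n +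
              b * (1 + a - c) * (1 + a - e) * cubicSum a b c e n) +
            ((3 * (n : ℚ) + (a + 1)) * (a * (a - b) * b * cubicWeight (a + 1) (b + 2) c e n) +
              b * (1 + a - c) * (1 + a - e) * ((3 * (n : ℚ) + a) * cubicWeight a b c e n)) := by
          ring
      _ = _ := by
          rw [ih, hw]
          obtain rfl : e = 2 * a + 1 - b - c := by linarith
          push_cast
          field_simp
          ring

/-- The contiguity relation behind the summation formulas below. -/
theorem cubicSum_contiguous {a b c e : ℚ} {K : ℕ} (hsum : b + c + e = 2 * a + 1)
    (hb0 : b ≠ 0) (hab : a - b ≠ 0) (hb : ∀ j < K, 1 + a - b + (j : ℚ) ≠ 0)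
    (hc : ∀ j < K, 1 + a - c + (j : ℚ) ≠ 0) (he : ∀ j < K, 1 + a - e + (j : ℚ) ≠ 0)
    (hK : cubicWeight a b c e K = 0) :
    (1 + a - c) * (1 + a - e) * cubicSum a b c e K =
      -(a * (a - b)) * cubicSum (a + 1) (b + 2) c e K := by
  have h := cubicSum_shift_add hsum hab hb hc he le_rfl
  rw [hK, mul_zero] at h
  apply mul_left_cancel₀ hb0
  linear_combination h

theorem cubicWeight_eq_zero_of_left {n K : ℕ} (h : n < K) (b c e : ℚ) :
    cubicWeight (-n) b c e K = 0 :=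
  prod_eq_zero (mem_range.2 h) (by simp)

theorem cubicWeight_eq_zero_of_right {m K : ℕ} (h : m < K) (a c e : ℚ) :
    cubicWeight a (-(2 * m)) c e K = 0 :=
  prod_eq_zero (mem_range.2 h) (by simp)

/-- The series terminated by its first parameter vanishes. -/
theorem cubicSum_neg_eq_zero {c e : ℚ} {K : ℕ} (hce : 1 < c + e)
    (hc : ∀ n < K, ∀ j < K, (1 : ℚ) - n - c + j ≠ 0)
    (he : ∀ n < K, ∀ j < K, (1 : ℚ) - n - e + j ≠ 0) {n : ℕ} (hn : n < K) :
    cubicSum (-n) (1 - 2 * n - c - e) c e K = 0 := by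
  induction n with
  | zero =>
    refine sum_eq_zero fun k _ ↦ ?_
    rcases k with _ | k
    · simp
    · rw [cubicWeight_eq_zero_of_left (Nat.succ_pos k), mul_zero]
  | succ n ih =>
    have ih := ih (by omega)
    have hn0 : (0 : ℚ) ≤ n := n.cast_nonneg
    have key := cubicSum_contiguous (a := -((n + 1 : ℕ) : ℚ))
      (b := 1 - 2 * ((n + 1 : ℕ) : ℚ) - c - e) (c := c) (e := e) (K := K) (by ring)
      (by push_cast; intro h; linarith) (by push_cast; intro h; linarith)
      (fun j _ h ↦ by
        have : (0 : ℚ) ≤ j := j.cast_nonneg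
        push_cast at h; linarith)
      (fun j hj h ↦ hc _ hn j hj (by linear_combination h))
      (fun j hj h ↦ he _ hn j hj (by linear_combination h))
      (cubicWeight_eq_zero_of_left hn _ _ _)
    have e1 : -((n + 1 : ℕ) : ℚ) + 1 = -n := by push_cast; ring
    have e2 : 1 - 2 * ((n + 1 : ℕ) : ℚ) - c - e + 2 = 1 - 2 * n - c - e := by push_cast; ring
    rw [e1, e2, ih, mul_zero] at key
    refine (mul_eq_zero.1 key).resolve_left (mul_ne_zero ?_ ?_)
    · intro h; exact hc _ hn 0 (by omega) (by push_cast at h ⊢; linear_combination h)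
    · intro h; exact he _ hn 0 (by omega) (by push_cast at h ⊢; linear_combination h)

/-- The series terminated by an even numerator parameter, in closed form. -/
theorem cubicSum_terminating {K m : ℕ} (hm : m < K) {a c e : ℚ} (ha : 0 < a)
    (hce : c + e = 2 * a + 1 + 2 * m)
    (hc : ∀ n < m + K, 1 + a - c + (n : ℚ) ≠ 0) (he : ∀ n < m + K, 1 + a - e + (n : ℚ) ≠ 0) :
    cubicSum a (-(2 * m)) c e K * ∏ j ∈ range (2 * m), (1 + a - c + j) =
      ∏ j ∈ range (2 * m + 1), (a + j) := by
  induction m generalizing a with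
  | zero =>
    obtain ⟨K, rfl⟩ := Nat.exists_eq_add_of_lt hm
    rw [cubicSum, zero_add, sum_range_succ', sum_eq_zero]
    · simp [cubicWeight]
    · intro k _
      rw [cubicWeight_eq_zero_of_right (Nat.succ_pos k), mul_zero]
  | succ m ih =>
    have ih := ih (by omega) (a := a + 1) (by linarith) (by push_cast at hce; linarith)
      (fun n hn h ↦ hc (n + 1) (by omega) (by push_cast; linear_combination h))
      (fun n hn h ↦ he (n + 1) (by omega) (by push_cast; linear_combination h))
    have hm0 : (0 : ℚ) ≤ m := m.cast_nonneg
    have key := cubicSum_contiguous (a := a) (b := -(2 * ((m + 1 : ℕ) : ℚ))) (c := c) (e := e)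
      (K := K) (by linear_combination hce) (by push_cast; intro h; linarith)
      (by push_cast; intro h; linarith)
      (fun j _ h ↦ by
        have : (0 : ℚ) ≤ j := j.cast_nonneg
        push_cast at h; linarith)
      (fun j hj ↦ hc j (by omega)) (fun j hj ↦ he j (by omega))
      (cubicWeight_eq_zero_of_right hm _ _ _)
    have e2 : -(2 * ((m + 1 : ℕ) : ℚ)) + 2 = -(2 * m) := by push_cast; ring
    rw [e2] at key
    have h0 := he 0 (by omega)
    obtain rfl : e = 2 * a + 1 + 2 * ((m + 1 : ℕ) : ℚ) - c := by linarith
    rw [show 2 * (m + 1) = (2 * m + 1) + 1 by ring, prod_range_succ, prod_range_succ',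
      prod_range_succ, prod_range_succ' _ (2 * m + 1)]
    have r1 : ∏ j ∈ range (2 * m), (1 + a - c + ((j + 1 : ℕ) : ℚ)) =
        ∏ j ∈ range (2 * m), (1 + (a + 1) - c + (j : ℚ)) :=
      prod_congr rfl fun j _ ↦ by push_cast; ring
    have r2 : ∏ j ∈ range (2 * m + 1), (a + ((j + 1 : ℕ) : ℚ)) =
        ∏ j ∈ range (2 * m + 1), (a + 1 + (j : ℚ)) :=
      prod_congr rfl fun j _ ↦ by push_cast; ring
    rw [r1, r2, ← ih]
    push_cast at key ⊢
    linear_combination (-∏ j ∈ range (2 * m), (1 + (a + 1) - c + (j : ℚ))) * key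

/-- The rationals whose denominator is prime to `p`. -/
def localIntegers {p : ℕ} (hp : p.Prime) : Subring ℚ where
  carrier := {x | ∃ n d : ℤ, ¬ (p : ℤ) ∣ d ∧ x * d = n}
  mul_mem' := by
    rintro x y ⟨n, d, hd, h⟩ ⟨n', d', hd', h'⟩
    refine ⟨n * n', d * d', fun hdvd ↦ ?_, ?_⟩
    · exact ((Nat.prime_iff_prime_int.1 hp).dvd_or_dvd hdvd).elim hd hd'
    · push_cast; rw [← h, ← h']; ring
  add_mem' := by
    rintro x y ⟨n, d, hd, h⟩ ⟨n', d', hd', h'⟩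
    refine ⟨n * d' + n' * d, d * d', fun hdvd ↦ ?_, ?_⟩
    · exact ((Nat.prime_iff_prime_int.1 hp).dvd_or_dvd hdvd).elim hd hd'
    · push_cast; rw [← h, ← h']; ring
  neg_mem' := by
    rintro x ⟨n, d, hd, h⟩
    exact ⟨-n, d, hd, by push_cast; rw [← h]; ring⟩
  zero_mem' := ⟨0, 1, fun h ↦ hp.one_lt.ne' (by simpa using Int.natAbs_dvd_natAbs.2 h), by simp⟩
  one_mem' := ⟨1, 1, fun h ↦ hp.one_lt.ne' (by simpa using Int.natAbs_dvd_natAbs.2 h), by simp⟩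

theorem inv_mem_localIntegers {p : ℕ} (hp : p.Prime) {n : ℤ} (hn : ¬ (p : ℤ) ∣ n) :
    (n : ℚ)⁻¹ ∈ localIntegers hp :=
  ⟨1, n, hn, by
    have : (n : ℚ) ≠ 0 := by rintro h; exact hn (by simp [Int.cast_eq_zero.1 h])
    simp [this]⟩

theorem dvd_num_of_eq_pow_mul {p : ℕ} (hp : p.Prime) {k : ℕ} {x y : ℚ}
    (hy : y ∈ localIntegers hp) (h : x = (p : ℚ) ^ k * y) :
    (p : ℤ) ^ k ∣ x.num ∧ ¬ (p : ℤ) ∣ (x.den : ℤ) := by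
  obtain ⟨n, d, hd, hnd⟩ := hy
  have hx : x * d = (((p : ℤ) ^ k * n : ℤ) : ℚ) := by push_cast; rw [h, ← hnd]; ring
  have hx' : x.num * d = (p : ℤ) ^ k * n * x.den := by
    have hden : (x.den : ℚ) ≠ 0 := by exact_mod_cast x.den_nz
    have := congrArg (· * (x.den : ℚ)) hx
    rw [mul_right_comm, Rat.mul_den_eq_num] at this
    exact_mod_cast this
  have hpp := Nat.prime_iff_prime_int.1 hp
  constructor
  · have hco : IsCoprime ((p : ℤ) ^ k) d := ((hpp.coprime_iff_not_dvd).2 hd).pow_left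
    exact hco.dvd_of_dvd_mul_right ⟨n * x.den, by rw [hx']; ring⟩
  · intro hpd
    have h1 : (x.den : ℤ) ∣ d := by
      have hco : IsCoprime (x.den : ℤ) x.num :=
        (Int.isCoprime_iff_gcd_eq_one.2 (by simpa [Int.gcd] using x.reduced)).symm
      exact hco.dvd_of_dvd_mul_left ⟨(p : ℤ) ^ k * n, by rw [hx']; ring⟩
    exact hd (hpd.trans h1)

/-- Functions `f` for which `f i` agrees modulo `π ^ 4` with a polynomial in the quantities
`π α i`, `π ^ 2 x i`, `π ^ 3 y i` of weights one, two, three, when `α ^ 2 = -α`. -/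
def cubicJets {R ι : Type*} [CommRing R] (π : R) {α : ι → R} (hα : ∀ i, α i ^ 2 = -α i)
    (x y : ι → R) : Subring (ι → R) where
  carrier := {f | ∃ (c₀ c₁ c₂ c₃ c₄ : R) (r : ι → R), ∀ i,
    f i = c₀ + π * α i * c₁ + π ^ 2 * x i * c₂ + π ^ 3 * (α i * x i) * c₃ + π ^ 3 * y i * c₄ +
      π ^ 4 * r i}
  mul_mem' := by
    rintro f g ⟨c₀, c₁, c₂, c₃, c₄, r, h⟩ ⟨d₀, d₁, d₂, d₃, d₄, s, h'⟩
    refine ⟨c₀ * d₀, c₀ * d₁ + c₁ * d₀ - π * c₁ * d₁, c₀ * d₂ + c₂ * d₀,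
      c₀ * d₃ + c₃ * d₀ + c₁ * d₂ + c₂ * d₁, c₀ * d₄ + c₄ * d₀,
      fun i ↦ -(α i * x i * (c₁ * d₃ + c₃ * d₁)) + α i * y i * (c₁ * d₄ + c₄ * d₁) +
        x i ^ 2 * c₂ * d₂ + π * x i * (c₂ * (α i * x i * d₃ + y i * d₄) +
          d₂ * (α i * x i * c₃ + y i * c₄)) +
        π ^ 2 * (α i * x i * c₃ + y i * c₄) * (α i * x i * d₃ + y i * d₄) +
        r i * g i + (f i - π ^ 4 * r i) * s i, fun i ↦ ?_⟩
    simp only [Pi.mul_apply, h i, h' i]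
    linear_combination (π ^ 2 * c₁ * d₁ + π ^ 4 * x i * (c₁ * d₃ + c₃ * d₁)) * hα i
  add_mem' := by
    rintro f g ⟨c₀, c₁, c₂, c₃, c₄, r, h⟩ ⟨d₀, d₁, d₂, d₃, d₄, s, h'⟩
    refine ⟨c₀ + d₀, c₁ + d₁, c₂ + d₂, c₃ + d₃, c₄ + d₄, r + s, fun i ↦ ?_⟩
    simp only [Pi.add_apply, h i, h' i]
    ring
  neg_mem' := by
    rintro f ⟨c₀, c₁, c₂, c₃, c₄, r, h⟩
    refine ⟨-c₀, -c₁, -c₂, -c₃, -c₄, -r, fun i ↦ ?_⟩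
    simp only [Pi.neg_apply, h i]
    ring
  zero_mem' := ⟨0, 0, 0, 0, 0, 0, fun i ↦ by simp⟩
  one_mem' := ⟨1, 0, 0, 0, 0, 0, fun i ↦ by simp⟩

section

variable {R ι : Type*} [CommRing R] {π : R} {α : ι → R} {hα : ∀ i, α i ^ 2 = -α i} {x y : ι → R}

theorem const_mem_cubicJets (c : R) : (fun _ ↦ c) ∈ cubicJets π hα x y :=
  ⟨c, 0, 0, 0, 0, 0, fun i ↦ by simp⟩

theorem weightOne_mem_cubicJets : (fun i ↦ π * α i) ∈ cubicJets π hα x y :=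
  ⟨0, 1, 0, 0, 0, 0, fun i ↦ by simp⟩

theorem weightTwo_mem_cubicJets : (fun i ↦ π ^ 2 * x i) ∈ cubicJets π hα x y :=
  ⟨0, 0, 1, 0, 0, 0, fun i ↦ by simp⟩

theorem weightThree_mem_cubicJets : (fun i ↦ π ^ 3 * y i) ∈ cubicJets π hα x y :=
  ⟨0, 0, 0, 0, 1, 0, fun i ↦ by simp⟩

theorem pow_four_mul_mem_cubicJets (r : ι → R) :
    (fun i ↦ π ^ 4 * r i) ∈ cubicJets π hα x y :=
  ⟨0, 0, 0, 0, 0, r, fun i ↦ by simp⟩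

theorem inverse_mem_cubicJets {f g h : ι → R} {u v : R} (hf : f ∈ cubicJets π hα x y)
    (hfg : ∀ i, f i * g i = 1) (huv : u * v = 1) (hfu : ∀ i, f i = u + π * h i) :
    g ∈ cubicJets π hα x y := by
  set X : ι → R := 1 - f * (fun _ ↦ v) with hX
  have hXm : X ∈ cubicJets π hα x y :=
    sub_mem (one_mem _) (mul_mem hf (const_mem_cubicJets v))
  have hg : g = (fun _ ↦ v) * (1 + X + X ^ 2 + X ^ 3) + fun i ↦ π ^ 4 * ((h i * v) ^ 4 * g i) := by
    funext i
    have hXi : X i = -(π * (h i * v)) := by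
      simp only [hX, Pi.sub_apply, Pi.one_apply, Pi.mul_apply, hfu i]
      linear_combination -huv
    have h4 : X i ^ 4 = π ^ 4 * (h i * v) ^ 4 := by rw [hXi]; ring
    simp only [Pi.add_apply, Pi.mul_apply, Pi.one_apply, Pi.pow_apply]
    rw [← mul_assoc, ← h4]
    have hXi' : X i = 1 - f i * v := rfl
    rw [hXi']
    linear_combination (v * (1 + (1 - f i * v) + (1 - f i * v) ^ 2 + (1 - f i * v) ^ 3)) * hfg i
  rw [hg]
  exact add_mem (mul_mem (const_mem_cubicJets v) (add_mem (add_mem (add_mem (one_mem _) hXm)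
    (pow_mem hXm 2)) (pow_mem hXm 3))) (pow_four_mul_mem_cubicJets _)

end

section

/-- Index `(t, β, γ)`: the parameter `α` is `-1` or `0` according to `t`. -/
def idxA (i : Bool × ℤ × ℤ) : ℤ := if i.1 then -1 else 0

/-- The last parameter, fixed by the balancing condition. -/
def idxE (i : Bool × ℤ × ℤ) : ℤ := 2 * idxA i - i.2.1 - i.2.2

/-- Second elementary symmetric function of the parameters. -/
def idxTwo (i : Bool × ℤ × ℤ) : ℤ := i.2.1 * i.2.2 + (i.2.1 + i.2.2) * idxE i

/-- Third elementary symmetric function of the parameters. -/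
def idxThree (i : Bool × ℤ × ℤ) : ℤ := i.2.1 * i.2.2 * idxE i

theorem idxA_sq (i : Bool × ℤ × ℤ) : idxA i ^ 2 = -idxA i := by
  unfold idxA; split_ifs <;> norm_num

variable {p : ℕ} (hp : p.Prime)

/-- Rational valued functions of the parameters that are jets over the local integers. -/
def ratJets : Subring (Bool × ℤ × ℤ → ℚ) :=
  (cubicJets (p : localIntegers hp) (α := fun i ↦ (idxA i : localIntegers hp))
    (fun i ↦ by exact_mod_cast congrArg (Int.cast (R := localIntegers hp)) (idxA_sq i))
    (fun i ↦ (idxTwo i : localIntegers hp)) (fun i ↦ (idxThree i : localIntegers hp))).map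
    ((localIntegers hp).subtype.compLeft _)

variable {hp}

theorem weightOne_mem_ratJets : (fun i ↦ (p : ℚ) * idxA i) ∈ ratJets hp :=
  ⟨_, weightOne_mem_cubicJets, by funext i; simp⟩

theorem weightTwo_mem_ratJets : (fun i ↦ (p : ℚ) ^ 2 * idxTwo i) ∈ ratJets hp :=
  ⟨_, weightTwo_mem_cubicJets, by funext i; simp⟩

theorem weightThree_mem_ratJets : (fun i ↦ (p : ℚ) ^ 3 * idxThree i) ∈ ratJets hp :=
  ⟨_, weightThree_mem_cubicJets, by funext i; simp⟩

theorem inv_mem_ratJets {f : Bool × ℤ × ℤ → ℚ} (hf : f ∈ ratJets hp) {u : ℤ}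
    (hu : ¬ (p : ℤ) ∣ u) {h : Bool × ℤ × ℤ → ℤ} (hfu : ∀ i, f i = u + p * h i) :
    f⁻¹ ∈ ratJets hp := by
  obtain ⟨F, hF, rfl⟩ := hf
  have hdvd : ∀ i, ¬ (p : ℤ) ∣ u + p * h i := fun i hi ↦
    hu ((Int.dvd_add_left (Int.dvd_mul_right _ _)).1 hi)
  have hne : ∀ {n : ℤ}, ¬ (p : ℤ) ∣ n → (n : ℚ) ≠ 0 := fun hn h0 ↦
    hn (by simp [Int.cast_eq_zero.1 h0])
  refine ⟨fun i ↦ ⟨_, inv_mem_localIntegers hp (hdvd i)⟩,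
    inverse_mem_cubicJets (u := u) (v := ⟨_, inv_mem_localIntegers hp hu⟩)
      (h := fun i ↦ (h i : localIntegers hp)) hF ?_ ?_ ?_, ?_⟩
  · intro i
    apply Subtype.ext
    have h1 : (F i : ℚ) = ((u + p * h i : ℤ) : ℚ) := by push_cast; exact hfu i
    push_cast [h1]
    exact mul_inv_cancel₀ (by exact_mod_cast hne (hdvd i))
  · apply Subtype.ext
    push_cast
    exact mul_inv_cancel₀ (hne hu)
  · intro i
    apply Subtype.ext
    push_cast
    exact hfu i
  · funext i
    simp only [RingHom.compLeft_apply, Function.comp, Pi.inv_apply, Subring.subtype_apply]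
    have := hfu i
    simp only [RingHom.compLeft_apply, Function.comp, Subring.subtype_apply] at this
    rw [this]
    push_cast
    rfl

theorem cubicSum_mem_ratJets (hp2 : p ≠ 2) :
    (fun i : Bool × ℤ × ℤ ↦ cubicSum (1 + p * idxA i) (1 + p * i.2.1) (1 + p * i.2.2)
      (1 + p * idxE i) p) ∈ ratJets hp := by
  have hnat : ∀ n : ℕ, (n : Bool × ℤ × ℤ → ℚ) ∈ ratJets hp := fun n ↦ natCast_mem _ n
  set A : Bool × ℤ × ℤ → ℚ := fun i ↦ (p : ℚ) * idxA i with hA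
  set E : Bool × ℤ × ℤ → ℚ := fun i ↦ (p : ℚ) ^ 2 * idxTwo i with hE
  set T : Bool × ℤ × ℤ → ℚ := fun i ↦ (p : ℚ) ^ 3 * idxThree i with hT
  have hAm : A ∈ ratJets hp := weightOne_mem_ratJets
  have hEm : E ∈ ratJets hp := weightTwo_mem_ratJets
  have hTm : T ∈ ratJets hp := weightThree_mem_ratJets
  have hnum : ∀ j : ℕ, (((j + 1 : ℕ) + A) * ((2 * j + 1 : ℕ) ^ 3 + (2 * j + 1 : ℕ) ^ 2 * (2 * A) +
      (2 * j + 1 : ℕ) * E + T) : Bool × ℤ × ℤ → ℚ) ∈ ratJets hp := fun j ↦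
    mul_mem (add_mem (hnat _) hAm) (add_mem (add_mem (add_mem (pow_mem (hnat _) _)
      (mul_mem (pow_mem (hnat _) _) (mul_mem (hnat 2) hAm))) (mul_mem (hnat _) hEm)) hTm)
  have hden : ∀ j : ℕ, (((2 * (j + 1) : ℕ)) * (((j + 1 : ℕ) + A) ^ 3 -
      ((j + 1 : ℕ) + A) ^ 2 * (2 * A) + ((j + 1 : ℕ) + A) * E - T) : Bool × ℤ × ℤ → ℚ)
      ∈ ratJets hp := fun j ↦
    have hB := add_mem (hnat (j + 1)) hAm
    mul_mem (hnat _) (sub_mem (add_mem (sub_mem (pow_mem hB _)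
      (mul_mem (pow_mem hB _) (mul_mem (hnat 2) hAm))) (mul_mem hB hEm)) hTm)
  have key : (fun i : Bool × ℤ × ℤ ↦ cubicSum (1 + p * idxA i) (1 + p * i.2.1) (1 + p * i.2.2)
      (1 + p * idxE i) p) = ∑ k ∈ range p, ((3 * k + 1 : ℕ) + A) * ∏ j ∈ range k,
        ((((j + 1 : ℕ) + A) * ((2 * j + 1 : ℕ) ^ 3 + (2 * j + 1 : ℕ) ^ 2 * (2 * A) +
          (2 * j + 1 : ℕ) * E + T)) * (((2 * (j + 1) : ℕ)) * (((j + 1 : ℕ) + A) ^ 3 -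
          ((j + 1 : ℕ) + A) ^ 2 * (2 * A) + ((j + 1 : ℕ) + A) * E - T))⁻¹) := by
    funext i
    simp only [cubicSum, cubicWeight, Finset.sum_apply, Finset.prod_apply, Pi.mul_apply,
      Pi.add_apply, Pi.inv_apply, Pi.natCast_apply, hA]
    refine sum_congr rfl fun k _ ↦ congrArg₂ _ (by push_cast; ring) (prod_congr rfl fun j _ ↦ ?_)
    rw [div_eq_mul_inv]
    congr 1
    · simp only [hE, hT, idxTwo, idxThree, idxE, Pi.pow_apply,
        Pi.natCast_apply, Pi.ofNat_apply]
      push_cast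
      ring
    · congr 1
      simp only [hE, hT, idxTwo, idxThree, idxE, Pi.add_apply, Pi.mul_apply, Pi.pow_apply,
        Pi.natCast_apply, Pi.ofNat_apply, Pi.sub_apply]
      push_cast
      ring
  rw [key]
  refine sum_mem fun k hk ↦ mul_mem (add_mem (hnat _) hAm) (prod_mem fun j hj ↦
    mul_mem (hnum j) ?_)
  have hj : j + 1 < p := by
    have := mem_range.1 hk
    have := mem_range.1 hj
    omega
  have hpp := Nat.prime_iff_prime_int.1 hp
  refine inv_mem_ratJets (hden j) (u := 2 * (j + 1) ^ 4) (fun hdvd ↦ ?_)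
    (h := fun i ↦ 2 * (j + 1) * ((j + 1) ^ 2 * ((idxA i - i.2.1) + (idxA i - i.2.2) +
      (idxA i - idxE i)) + p * (j + 1) * ((idxA i - i.2.1) * (idxA i - i.2.2) +
      (idxA i - i.2.1) * (idxA i - idxE i) + (idxA i - i.2.2) * (idxA i - idxE i)) +
      p ^ 2 * ((idxA i - i.2.1) * (idxA i - i.2.2) * (idxA i - idxE i)))) fun i ↦ ?_
  · rcases hpp.dvd_or_dvd hdvd with h | h
    · exact hp2 ((Nat.prime_dvd_prime_iff_eq hp Nat.prime_two).1 (by exact_mod_cast h))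
    · have := hpp.dvd_of_dvd_pow h
      exact Nat.not_dvd_of_pos_of_lt (Nat.succ_pos j) hj (by exact_mod_cast this)
  · simp only [hA, hE, hT, idxTwo, idxThree, idxE, Pi.add_apply, Pi.mul_apply, Pi.pow_apply,
      Pi.natCast_apply, Pi.ofNat_apply, Pi.sub_apply]
    push_cast
    ring

theorem exists_expansion_of_mem_ratJets {f : Bool × ℤ × ℤ → ℚ} (hf : f ∈ ratJets hp) :
    ∃ (c₀ c₁ c₂ c₃ c₄ : ℚ) (r : Bool × ℤ × ℤ → ℚ), (∀ i, r i ∈ localIntegers hp) ∧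
      ∀ i, f i = c₀ + p * idxA i * c₁ + p ^ 2 * idxTwo i * c₂ +
        p ^ 3 * (idxA i * idxTwo i) * c₃ + p ^ 3 * idxThree i * c₄ + p ^ 4 * r i := by
  obtain ⟨F, ⟨c₀, c₁, c₂, c₃, c₄, r, h⟩, rfl⟩ := hf
  refine ⟨c₀, c₁, c₂, c₃, c₄, fun i ↦ r i, fun i ↦ (r i).2, fun i ↦ ?_⟩
  simp only [RingHom.compLeft_apply, Function.comp, Subring.subtype_apply, h i]
  push_cast
  rfl

end

open Polynomial in
theorem prod_X_add_C_zmod {p : ℕ} [Fact p.Prime] :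
    ∏ j ∈ range (p - 1), (X + C ((j : ZMod p) + 1)) = (X ^ (p - 1) - 1 : (ZMod p)[X]) := by
  have hp : p.Prime := Fact.out
  have hp0 : p - 1 ≠ 0 := (Nat.sub_pos_of_lt hp.one_lt).ne'
  have hm : (∏ j ∈ range (p - 1), (X + C ((j : ZMod p) + 1))).Monic :=
    monic_prod_of_monic _ _ fun j _ ↦ monic_X_add_C _
  have hd : (∏ j ∈ range (p - 1), (X + C ((j : ZMod p) + 1))).degree =
      ((p - 1 : ℕ) : WithBot ℕ) := by
    rw [degree_prod]
    simp only [degree_X_add_C]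
    simp
  have hd' : ((X : (ZMod p)[X]) ^ (p - 1) - 1).degree = ((p - 1 : ℕ) : WithBot ℕ) := by
    simpa using degree_X_pow_sub_C (Nat.pos_of_ne_zero hp0) (1 : ZMod p)
  refine eq_of_degree_sub_lt_of_eval_finset_eq (univ.erase 0) ?_ fun x hx ↦ ?_
  · rw [card_erase_of_mem (mem_univ _), card_univ, ZMod.card, ← hd]
    refine degree_sub_lt_left (hd.trans hd'.symm) hm.ne_zero ?_
    rw [hm.leadingCoeff, ← C_1, leadingCoeff_X_pow_sub_C (Nat.pos_of_ne_zero hp0)]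
  · have hx0 : x ≠ 0 := (mem_erase.1 hx).1
    have h1 : 0 < x.val := Nat.pos_of_ne_zero ((ZMod.val_ne_zero x).2 hx0)
    have h2 := x.val_lt
    rw [eval_prod, prod_eq_zero (i := p - 1 - x.val) (mem_range.2 (by omega))]
    · simp [ZMod.pow_card_sub_one_eq_one hx0]
    · have h3 : ((x.val + (p - 1 - x.val) + 1 : ℕ) : ZMod p) = 0 := by
        rw [show x.val + (p - 1 - x.val) + 1 = p by omega, ZMod.natCast_self]
      push_cast [ZMod.natCast_zmod_val] at h3
      simpa [add_assoc] using h3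

open Polynomial in
theorem pow_three_dvd_prod_add_mul_sub_factorial {p : ℕ} (hp : p.Prime) (hp3 : 3 < p) (s : ℤ) :
    (p : ℤ) ^ 3 ∣ ∏ j ∈ range (p - 1), ((j : ℤ) + 1 + s * p) - ((p - 1).factorial : ℤ) := by
  have := Fact.mk hp
  set f : ℤ[X] := ∏ j ∈ range (p - 1), (X + C ((j : ℤ) + 1)) with hf
  have hev : ∀ x, f.eval x = ∏ j ∈ range (p - 1), (x + (j + 1)) := fun x ↦ by
    simp [hf, eval_prod]
  have hc2 : (p : ℤ) ∣ f.coeff 2 := by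
    rw [← ZMod.intCast_zmod_eq_zero_iff_dvd]
    have : f.map (Int.castRingHom (ZMod p)) = X ^ (p - 1) - 1 := by
      rw [← prod_X_add_C_zmod, hf, Polynomial.map_prod]
      simp
    have h2 := congrArg (coeff · 2) this
    simpa [coeff_X_pow, coeff_one, show 2 ≠ p - 1 by omega] using h2
  obtain ⟨d, hd⟩ := hc2
  have hexp : ∀ x, f.eval x = f.coeff 0 + f.coeff 1 * x + f.coeff 2 * x ^ 2 +
      x ^ 3 * f.divX.divX.divX.eval x := fun x ↦ by
    have h0 := congrArg (eval x) (divX_mul_X_add f)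
    have h1 := congrArg (eval x) (divX_mul_X_add f.divX)
    have h2 := congrArg (eval x) (divX_mul_X_add f.divX.divX)
    simp only [eval_add, eval_mul, eval_X, eval_C, coeff_divX] at h0 h1 h2
    norm_num at h1 h2
    rw [← h0, ← h1, ← h2]
    ring
  have hrefl : f.eval (-(p : ℤ)) = f.eval 0 := by
    have heven : Even (p - 1) := hp.even_sub_one (by omega)
    rw [hev, hev, ← prod_range_reflect]
    have : ∀ j ∈ range (p - 1), (-(p : ℤ) + ((p - 1 - 1 - j : ℕ) + 1)) = -1 * (0 + (j + 1)) := by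
      intro j hj
      have := mem_range.1 hj
      rw [show p - 1 - 1 - j = p - (j + 2) by omega, Nat.cast_sub (by omega)]
      push_cast
      ring
    rw [prod_congr rfl this, prod_mul_distrib, prod_const, card_range, heven.neg_one_pow, one_mul]
  have hfac : f.coeff 0 = ((p - 1).factorial : ℤ) := by
    rw [coeff_zero_eq_eval_zero, hev, ← prod_range_add_one_eq_factorial]
    push_cast
    simp
  have h1 : f.coeff 1 * p = d * p ^ 3 - p ^ 3 * f.divX.divX.divX.eval (-(p : ℤ)) := by
    rw [hexp, hexp, hd] at hrefl
    linear_combination -hrefl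
  have hs := hexp (s * p)
  rw [hev, hfac, hd] at hs
  have hcomm : ∏ j ∈ range (p - 1), ((j : ℤ) + 1 + s * p) =
      ∏ j ∈ range (p - 1), (s * p + ((j : ℤ) + 1)) := prod_congr rfl fun j _ ↦ by ring
  rw [hcomm, hs]
  exact ⟨s * (d - f.divX.divX.divX.eval (-(p : ℤ))) + d * s ^ 2 +
    s ^ 3 * f.divX.divX.divX.eval (s * p), by linear_combination s * h1⟩

theorem cubicSum_neg_mul_sub_mem {p : ℕ} (hp : p.Prime) (hp3 : 3 < p) {s : ℕ} (hs : 1 ≤ s) :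
    ∃ z ∈ localIntegers hp,
      cubicSum 1 (1 - p) (1 - s * p) (1 + (s + 1) * p) p - p = (p : ℚ) ^ 4 * z := by
  obtain ⟨m, hm⟩ := hp.odd_of_ne_two (by omega)
  have hmq : (p : ℚ) = 2 * m + 1 := by exact_mod_cast hm
  have hterm := cubicSum_terminating (K := p) (m := m) (by omega) (a := 1) (c := 1 - s * p)
    (e := 1 + (s + 1) * p) one_pos (by rw [hmq]; ring) (fun n _ ↦ by
      have : (0 : ℚ) ≤ s * p := by positivity
      have : (0 : ℚ) ≤ n := n.cast_nonneg
      intro h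
      linarith) (fun n hn h ↦ by
      have h1 : 1 + n = (s + 1) * p := by
        have : (1 + n : ℚ) = (s + 1) * p := by linarith
        exact_mod_cast this
      have h2 : 2 * p ≤ (s + 1) * p := Nat.mul_le_mul_right _ (by omega)
      omega)
  rw [show -(2 * (m : ℚ)) = 1 - p by rw [hmq]; ring] at hterm
  obtain ⟨w, hw⟩ := pow_three_dvd_prod_add_mul_sub_factorial hp hp3 s
  set D : ℤ := ∏ j ∈ range (p - 1), ((j : ℤ) + 1 + s * p) with hD
  have hDq : ∏ j ∈ range (2 * m), ((1 : ℚ) + 1 - (1 - s * p) + j) = (D : ℚ) := by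
    rw [hD, show p - 1 = 2 * m by omega]
    push_cast
    exact prod_congr rfl fun j _ ↦ by ring
  have hfac : ∏ j ∈ range (2 * m + 1), ((1 : ℚ) + j) = p * ((p - 1).factorial : ℚ) := by
    rw [← hm, ← Nat.cast_mul, Nat.mul_factorial_pred hp.ne_zero, ← prod_range_add_one_eq_factorial]
    push_cast
    exact prod_congr rfl fun j _ ↦ by ring
  rw [hDq, hfac] at hterm
  have hDp : ¬ (p : ℤ) ∣ D := fun h ↦ by
    have h1 : (p : ℤ) ∣ ((p - 1).factorial : ℤ) :=
      (dvd_sub_right h).1 (hw ▸ Dvd.intro _ (by ring : (p : ℤ) * (p ^ 2 * w) = p ^ 3 * w))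
    have h2 := (hp.dvd_factorial).1 (Int.natCast_dvd_natCast.1 h1)
    have := hp.pos
    omega
  have hD0 : (D : ℚ) ≠ 0 := fun h ↦ hDp (by simp [Int.cast_eq_zero.1 h])
  refine ⟨-w * (D : ℚ)⁻¹, mul_mem (neg_mem (intCast_mem _ w)) (inv_mem_localIntegers hp hDp), ?_⟩
  have hwq : (D : ℚ) - ((p - 1).factorial : ℚ) = p ^ 3 * w := by exact_mod_cast hw
  generalize cubicSum 1 (1 - p) (1 - s * p) (1 + (s + 1) * p) p = S at hterm ⊢
  field_simp
  linear_combination hterm - (p : ℚ) * hwq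

theorem cubicSum_neg_mul_eq_zero {p : ℕ} (hp : p.Prime) {β γ : ℤ} (hβ : β ≠ 0) (hγ : γ ≠ 0)
    (h : 0 ≤ β + γ) :
    cubicSum (1 + p * (-1 : ℤ)) (1 + p * (-2 - β - γ : ℤ)) (1 + p * β) (1 + p * γ) p = 0 := by
  have hne : ∀ {δ : ℤ}, δ ≠ 0 → ∀ n < p, ∀ j < p, (1 : ℚ) - n - (1 + p * δ) + j ≠ 0 := by
    intro δ hδ n hn j hj h0
    have h1 : ((j : ℤ) - n) = p * δ := by
      have : ((j : ℚ) - n) = p * δ := by linarith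
      exact_mod_cast this
    have h2 : |(j : ℤ) - n| < p := by rw [abs_lt]; omega
    have h3 := Int.eq_zero_of_abs_lt_dvd (Dvd.intro _ h1.symm) h2
    have hp0 : (p : ℤ) ≠ 0 := by exact_mod_cast hp.ne_zero
    exact hδ ((mul_eq_zero.1 (h1.symm.trans h3)).resolve_left hp0)
  have hq : (0 : ℚ) ≤ β + γ := by exact_mod_cast h
  have hpos := mul_nonneg (Nat.cast_nonneg (α := ℚ) p) hq
  have := cubicSum_neg_eq_zero (K := p) (c := 1 + p * β) (e := 1 + p * γ) (by linarith)
    (hne hβ) (hne hγ) (n := p - 1) (Nat.sub_lt hp.pos one_pos)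
  rw [Nat.cast_sub hp.one_le] at this
  push_cast at this ⊢
  convert this using 2 <;> ring

theorem cubicSum_one_sub_mem {p : ℕ} (hp : p.Prime) (hp3 : 3 < p) :
    ∃ z ∈ localIntegers hp, cubicSum 1 1 1 1 p - p = (p : ℚ) ^ 4 * z := by
  obtain ⟨c₀, c₁, c₂, c₃, c₄, r, hr, h⟩ :=
    exists_expansion_of_mem_ratJets (cubicSum_mem_ratJets (hp := hp) (by omega))
  obtain ⟨z₁, hz₁, h₁⟩ := cubicSum_neg_mul_sub_mem hp hp3 (s := 1) le_rfl
  obtain ⟨z₂, hz₂, h₂⟩ := cubicSum_neg_mul_sub_mem hp hp3 (s := 2) one_le_two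
  have a₁ := cubicSum_neg_mul_eq_zero hp (β := 1) (γ := -1) (by simp) (by simp) (by simp)
  have a₂ := cubicSum_neg_mul_eq_zero hp (β := 2) (γ := -1) (by simp) (by simp) (by simp)
  have a₃ := cubicSum_neg_mul_eq_zero hp (β := 2) (γ := -2) (by simp) (by simp) (by simp)
  have t₀ := h (false, 0, 0)
  have t₁ := h (false, -1, -1)
  have t₂ := h (false, -1, -2)
  have u₁ := h (true, -2, 1)
  have u₂ := h (true, -3, 2)
  have u₃ := h (true, -2, 2)
  norm_num [idxA, idxE, idxTwo, idxThree] at t₀ t₁ t₂ u₁ u₂ u₃ a₁ a₂ a₃ h₁ h₂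
  rw [a₁] at u₁
  rw [a₂] at u₂
  rw [a₃] at u₃
  have e₁ : (1 : ℚ) + -p = 1 - p := by ring
  have e₂ : (1 : ℚ) + -(p * 2) = 1 - 2 * p := by ring
  rw [e₁, mul_comm (p : ℚ) 2] at t₁
  rw [e₁, e₂, mul_comm (p : ℚ) 3] at t₂
  have h12 : ¬ (p : ℤ) ∣ 12 := fun hd ↦ by
    have hd' : p ∣ 2 ^ 2 * 3 := by exact_mod_cast hd
    rcases hp.dvd_mul.1 hd' with hd' | hd'
    · have := Nat.le_of_dvd two_pos (hp.dvd_of_dvd_pow hd')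
      omega
    · have := Nat.le_of_dvd three_pos hd'
      omega
  refine ⟨((12 : ℤ) : ℚ)⁻¹ * ((12 : ℤ) * r (false, 0, 0) +
    (r (true, -2, 1) + (3 : ℤ) * r (true, -3, 2) - (4 : ℤ) * r (true, -2, 2)) +
    (3 : ℤ) * ((7 : ℤ) * (z₁ - r (false, -1, -1)) - (3 : ℤ) * (z₂ - r (false, -1, -2)))),
    mul_mem (inv_mem_localIntegers hp h12) ?_, ?_⟩
  · have hi := intCast_mem (localIntegers hp)
    exact add_mem (add_mem (mul_mem (hi _) (hr _)) (sub_mem (add_mem (hr _)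
      (mul_mem (hi _) (hr _))) (mul_mem (hi _) (hr _)))) (mul_mem (hi _) (sub_mem
      (mul_mem (hi _) (sub_mem hz₁ (hr _))) (mul_mem (hi _) (sub_mem hz₂ (hr _)))))
  · push_cast
    linear_combination t₀ + (7 / 4) * (h₁ - t₁) - (3 / 4) * (h₂ - t₂) +
      (1 / 12) * (u₁ + 3 * u₂ - 4 * u₃)

theorem two_mul_natCast_sub_one_ne_zero (n : ℕ) : 2 * (n : ℚ) - 1 ≠ 0 := fun h ↦ by
  have : 2 * n = 1 := by
    have : 2 * (n : ℚ) = 1 := by linarith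
    exact_mod_cast this
  omega

theorem risingRat_half_sq_mul (k : ℕ) :
    risingRat (1 / 2) k * risingRat (-1 / 2) k ^ 2 / (k.factorial : ℚ) ^ 3 * 4 ^ k =
      cubicWeight 1 1 1 1 k / (2 * k - 1) ^ 2 := by
  rw [eq_div_iff (pow_ne_zero 2 (two_mul_natCast_sub_one_ne_zero k))]
  induction k with
  | zero => simp [risingRat, cubicWeight]
  | succ k ih =>
    have h1 : (k : ℚ) + 1 ≠ 0 := by positivity
    have h2 : (k.factorial : ℚ) ≠ 0 := by positivity
    rw [cubicWeight_succ, ← ih, Nat.factorial_succ, risingRat, risingRat, prod_range_succ,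
      prod_range_succ, ← risingRat, ← risingRat]
    push_cast
    field_simp
    ring

theorem sum_cubicWeight_div_sq (n : ℕ) :
    ∑ k ∈ range n, (3 * (k : ℚ) - 1) * (cubicWeight 1 1 1 1 k / (2 * k - 1) ^ 2) =
      cubicSum 1 1 1 1 n - 4 * n ^ 3 * cubicWeight 1 1 1 1 n / (2 * n - 1) ^ 2 := by
  induction n with
  | zero => simp [cubicSum]
  | succ n ih =>
    have h1 : (3 * (n : ℚ) - 1 - 4 * n ^ 3) / (2 * n - 1) ^ 2 = -(n + 1) := by
      rw [div_eq_iff (pow_ne_zero 2 (two_mul_natCast_sub_one_ne_zero n))]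
      ring
    have h2 : 4 * ((n + 1 : ℕ) : ℚ) ^ 3 * cubicWeight 1 1 1 1 (n + 1) /
        (2 * ((n + 1 : ℕ) : ℚ) - 1) ^ 2 = 2 * (2 * n + 1) * cubicWeight 1 1 1 1 n := by
      have h3 : (n : ℚ) + 1 ≠ 0 := by positivity
      rw [div_eq_iff (pow_ne_zero 2 (two_mul_natCast_sub_one_ne_zero (n + 1))), cubicWeight_succ,
        show (1 : ℚ) + 1 - 1 + n = n + 1 by ring]
      push_cast
      field_simp
      ring
    rw [sum_range_succ, ih, cubicSum_succ, h2]
    linear_combination cubicWeight 1 1 1 1 n * h1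

theorem cubicWeight_one_mul_pow (n : ℕ) :
    cubicWeight 1 1 1 1 n * 16 ^ n = (n.centralBinom : ℚ) ^ 3 := by
  induction n with
  | zero => simp [cubicWeight]
  | succ n ih =>
    have h : ((n : ℚ) + 1) * (n + 1).centralBinom = 2 * (2 * n + 1) * n.centralBinom := by
      exact_mod_cast Nat.succ_mul_centralBinom_succ n
    have h1 : (n : ℚ) + 1 ≠ 0 := by positivity
    have h2 : ((n + 1).centralBinom : ℚ) = 2 * (2 * n + 1) * n.centralBinom / (n + 1) := by
      rw [eq_div_iff h1, ← h]
      ring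
    rw [cubicWeight_succ, h2, div_pow, mul_pow, ← ih]
    rw [show (1 : ℚ) + 1 - 1 + n = n + 1 by ring]
    field_simp
    ring

theorem two_sub_cubicWeight_mem {p : ℕ} (hp : p.Prime) (hp2 : p ≠ 2) :
    ∃ z ∈ localIntegers hp,
      2 - 4 * cubicWeight 1 1 1 1 p / (2 * p - 1) ^ 2 = (p : ℚ) * z := by
  have := Fact.mk hp
  have hcb : ((p.centralBinom : ℤ) : ZMod p) = 2 := by
    have := Choose.choose_modEq_choose_mod_mul_choose_div_nat (p := p) (n := 2 * p) (k := p)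
    rw [Nat.mul_mod_left, Nat.mod_self, Nat.mul_div_cancel _ hp.pos, Nat.div_self hp.pos] at this
    have := (ZMod.natCast_eq_natCast_iff _ _ _).2 this
    simpa [Nat.centralBinom] using this
  obtain ⟨N, hN⟩ : ∃ N : ℤ, N = (2 * p - 1) ^ 2 * 16 ^ p := ⟨_, rfl⟩
  have hNz : (N : ZMod p) = 16 := by
    rw [hN]
    push_cast
    rw [ZMod.pow_card]
    simp
  have hNp : ¬ (p : ℤ) ∣ N := fun h ↦ by
    have h1 : ((2 ^ 4 : ℕ) : ZMod p) = 0 := by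
      rw [← (ZMod.intCast_zmod_eq_zero_iff_dvd N p).2 h, hNz]
      norm_num
    have h2 := hp.dvd_of_dvd_pow ((ZMod.natCast_eq_zero_iff _ _).1 h1)
    exact hp2 ((Nat.prime_dvd_prime_iff_eq hp Nat.prime_two).1 h2)
  have hdvd : (p : ℤ) ∣ 2 * N - 4 * (p.centralBinom : ℤ) ^ 3 := by
    rw [← ZMod.intCast_zmod_eq_zero_iff_dvd, Int.cast_sub, Int.cast_mul, Int.cast_mul,
      Int.cast_pow, hNz, hcb]
    norm_num
  obtain ⟨w, hw⟩ := hdvd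
  refine ⟨w * (N : ℚ)⁻¹, mul_mem (intCast_mem _ w) (inv_mem_localIntegers hp hNp), ?_⟩
  have hN0 : (N : ℚ) ≠ 0 := fun h ↦ hNp (by simp [Int.cast_eq_zero.1 h])
  have hwq : 2 * (N : ℚ) - 4 * (p.centralBinom : ℚ) ^ 3 = p * w := by exact_mod_cast hw
  have hNq : (N : ℚ) = (2 * p - 1) ^ 2 * 16 ^ p := by rw [hN]; push_cast; rfl
  have h1 : (2 * (p : ℚ) - 1) ^ 2 ≠ 0 := fun h ↦ hN0 (by rw [hNq, h, zero_mul])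
  rw [← cubicWeight_one_mul_pow] at hwq
  rw [← mul_assoc, ← hwq, ← div_eq_mul_inv, eq_div_iff hN0, hNq]
  generalize (2 * (p : ℚ) - 1) ^ 2 = Q at h1 ⊢
  field_simp

theorem stmt_6 (p : ℕ) (hp : p.Prime) (hp3 : 3 < p) (x : ℚ)
    (hx : x = (∑ k ∈ Finset.range p,
        (3 * (k : ℚ) - 1) *
          (risingRat (1 / 2) k * (risingRat (-1 / 2) k) ^ 2 / ((k.factorial : ℚ)) ^ 3) *
          4 ^ k) -
      ((p : ℚ) - 2 * (p : ℚ) ^ 3)) :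
    (p : ℤ) ^ 4 ∣ x.num ∧ ¬ (p : ℤ) ∣ (x.den : ℤ) := by
  obtain ⟨y, hy, h⟩ := cubicSum_one_sub_mem hp hp3
  obtain ⟨z, hz, h'⟩ := two_sub_cubicWeight_mem hp (by omega)
  refine dvd_num_of_eq_pow_mul hp (add_mem hy hz) ?_
  simp only [mul_assoc (3 * (_ : ℚ) - 1), risingRat_half_sq_mul] at hx
  rw [hx, sum_cubicWeight_div_sq]
  linear_combination h + (p : ℚ) ^ 3 * h'
end

section
/- For any prime p > 3 and any integer r ≥ 2, the following congruence of rational numbers holds: Σ_{k=0}^{p^r-1} (3k-1) · ((1/2)_k · (-1/2)_k^2 / (k!)^3) · 4^k ≡ p^r (mod p^{r+3}), i.e., the difference of the two sides is a rational number whose numerator (in lowest terms) is divisible by p^{r+3} and whose denominator is coprime to p. -/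
open Finset

section ExactEvaluation

variable {K : Type*} [Field K]

/-- The rising factorial `a (a + 1) ⋯ (a + n - 1)` in a field. -/
def rise (a : K) (n : ℕ) : K := ∏ i ∈ range n, (a + i)

lemma rise_succ (a : K) (n : ℕ) : rise a (n + 1) = rise a n * (a + n) :=
  prod_range_succ _ _

lemma rise_succ_left (a : K) (n : ℕ) : rise a (n + 1) = a * rise (a + 1) n := by
  rw [rise, prod_range_succ', rise, mul_comm]
  simp only [Nat.cast_zero, add_zero, Nat.cast_add, Nat.cast_one]
  congr 1
  exact prod_congr rfl fun i _ => by ring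

lemma rise_reflect_sq (a : K) (n : ℕ) : rise (1 - n - a) n ^ 2 = rise a n ^ 2 := by
  have h : rise (1 - n - a) n = ∏ i ∈ range n, -(a + i) := by
    rw [rise, ← prod_range_reflect]
    refine prod_congr rfl fun i hi => ?_
    have hi' : i + 1 ≤ n := mem_range.1 hi
    rw [Nat.sub_sub, add_comm 1 i, Nat.cast_sub hi']
    push_cast
    ring
  rw [h, prod_neg, mul_pow, ← pow_mul, mul_comm _ 2, pow_mul]
  simp [rise]

/-- The `b`-free part of the summand. -/
def weight (K : Type*) [Field K] (n : ℕ) : K := rise (1 / 2) n * 4 ^ n / (n.factorial : K) ^ 3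

/-- The truncated sum `∑ (3n + 2b) (1/2)_n (b)_n² 4ⁿ / n!³`. -/
def truncSum (N : ℕ) (b : K) : K :=
  ∑ n ∈ range N, (3 * n + 2 * b) * (weight K n * rise b n ^ 2)

lemma truncSum_succ (N : ℕ) (b : K) :
    truncSum (N + 1) b = truncSum N b + (3 * N + 2 * b) * (weight K N * rise b N ^ 2) :=
  sum_range_succ _ _

open Polynomial in
lemma exists_polynomial_truncSum (N : ℕ) :
    ∃ S : K[X], ∀ b, S.eval b = truncSum N b := by
  refine ⟨∑ n ∈ range N, (C (3 * (n : K)) + C 2 * X) *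
    (C (weight K n) * (∏ i ∈ range n, (X + C (i : K))) ^ 2), fun b => ?_⟩
  simp [truncSum, rise, eval_finsetSum, eval_prod]

lemma rise_natCast_add_one (n m : ℕ) :
    rise ((m : K) + 1) n * m.factorial = (m + n).factorial := by
  induction n with
  | zero => simp [rise]
  | succ n ih =>
    rw [rise_succ, ← Nat.add_assoc, Nat.factorial_succ]
    push_cast
    rw [← ih]
    ring

variable [CharZero K]

lemma weight_succ (n : ℕ) :
    ((n : K) + 1) ^ 3 * weight K (n + 1) = weight K n * (4 * n + 2) := by
  have h1 : (n.factorial : K) ≠ 0 := Nat.cast_ne_zero.2 n.factorial_ne_zero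
  have h2 : (n : K) + 1 ≠ 0 := n.cast_add_one_ne_zero
  rw [weight, weight, rise_succ, Nat.factorial_succ]
  push_cast
  field_simp
  ring

lemma truncSum_succ_sub (n : ℕ) (b : K) :
    truncSum (n + 1) (b + 1) - truncSum (n + 1) b =
      ((n : K) + 1) ^ 3 * weight K (n + 1) * rise (b + 1) n ^ 2 := by
  induction n with
  | zero => rw [weight_succ]; simp [truncSum, weight, rise]; ring
  | succ n ih =>
    rw [truncSum_succ (n + 1), truncSum_succ (n + 1), add_sub_add_comm, ih,
      weight_succ (n + 1), rise_succ_left b, rise_succ (b + 1)]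
    push_cast
    ring

lemma truncSum_neg_natCast (n m : ℕ) (hm : m ≤ n) : truncSum (n + 1) (-(m : K)) = 0 := by
  induction m with
  | zero =>
    refine sum_eq_zero fun k _ => ?_
    rcases k with _ | k
    · simp
    · rw [rise_succ_left]; simp
  | succ m ih =>
    have h := truncSum_succ_sub n (-((m + 1 : ℕ) : K))
    have e : -((m + 1 : ℕ) : K) + 1 = -(m : K) := by push_cast; ring
    have hz : rise (-(m : K)) n = 0 := prod_eq_zero (mem_range.2 hm) (by ring)
    rw [e, ih (by omega), hz] at h
    linear_combination -h

open Polynomial in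
/-- The truncated sum is odd about `(1 - N) / 2`. -/
lemma truncSum_antisymm (n : ℕ) (b : K) :
    truncSum (n + 1) b + truncSum (n + 1) (-n - b) = 0 := by
  obtain ⟨S, hS⟩ := exists_polynomial_truncSum (K := K) (n + 1)
  have hH : ∀ b, (S + S.comp (C (-(n : K)) - X)).eval b =
      truncSum (n + 1) b + truncSum (n + 1) (-n - b) := by simp [hS]
  have hnat : ∀ k : ℕ, (S + S.comp (C (-(n : K)) - X)).eval (k : K) = 0 := by
    intro k
    rw [hH]
    induction k with
    | zero =>
      have h0 := truncSum_neg_natCast (K := K) n 0 (Nat.zero_le _)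
      have hn := truncSum_neg_natCast (K := K) n n le_rfl
      simp only [Nat.cast_zero, neg_zero, sub_zero] at h0 ⊢
      rw [h0, hn, add_zero]
    | succ k ih =>
      have h1 := truncSum_succ_sub n (k : K)
      have h2 := truncSum_succ_sub n (-n - ((k + 1 : ℕ) : K))
      have e : -(n : K) - ((k + 1 : ℕ) : K) + 1 = -n - k := by push_cast; ring
      have e' : -(n : K) - k = 1 - n - (k + 1) := by ring
      have hr : rise (-(n : K) - k) n ^ 2 = rise ((k : K) + 1) n ^ 2 := by
        rw [e', rise_reflect_sq]
      rw [e, hr] at h2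
      push_cast at h1 h2 ⊢
      linear_combination h1 - h2 + ih
  have hzero : S + S.comp (C (-(n : K)) - X) = 0 :=
    eq_zero_of_infinite_isRoot _
      ((Set.infinite_range_of_injective (Nat.cast_injective (R := K))).mono
        (by rintro _ ⟨k, rfl⟩; exact hnat k))
  rw [← hH, hzero, eval_zero]

/-- `P(b) = (b + 1)_n / n!`. -/
def riseRatio (n : ℕ) (b : K) : K := rise (b + 1) n / n.factorial

lemma rise_half (n : ℕ) : rise (1 / 2 : K) n * 4 ^ n * n.factorial = (2 * n).factorial := by
  induction n with
  | zero => simp [rise]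
  | succ n ih =>
    rw [rise_succ, show 2 * (n + 1) = 2 * n + 1 + 1 by ring, Nat.factorial_succ,
      Nat.factorial_succ, Nat.factorial_succ]
    push_cast
    rw [← ih]
    ring

lemma leading_factor (n : ℕ) :
    ((n : K) + 1) ^ 3 * weight K (n + 1) =
      2 * ((n : K) + 1) * riseRatio n ((n : K) + 1) / (n.factorial : K) ^ 2 := by
  have h1 := rise_half (K := K) (n + 1)
  have h2 := rise_natCast_add_one (K := K) n (n + 1)
  have hn : (n.factorial : K) ≠ 0 := Nat.cast_ne_zero.2 n.factorial_ne_zero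
  have hn' : (n : K) + 1 ≠ 0 := n.cast_add_one_ne_zero
  rw [show 2 * (n + 1) = n + 1 + n + 1 by ring, Nat.factorial_succ (n + 1 + n), Nat.cast_mul,
    ← h2, Nat.factorial_succ] at h1
  push_cast at h1
  have h3 : rise (1 / 2 : K) (n + 1) * 4 ^ (n + 1) =
      2 * (n + 1) * rise ((n : K) + 1 + 1) n := by
    apply mul_right_cancel₀ (mul_ne_zero hn' hn)
    linear_combination h1
  rw [weight, h3, riseRatio, Nat.factorial_succ]
  push_cast
  field_simp

lemma truncSum_succ_sub_riseRatio (n : ℕ) (b : K) :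
    truncSum (n + 1) (b + 1) - truncSum (n + 1) b =
      2 * ((n : K) + 1) * riseRatio n ((n : K) + 1) * riseRatio n b ^ 2 := by
  have hn : (n.factorial : K) ≠ 0 := Nat.cast_ne_zero.2 n.factorial_ne_zero
  rw [truncSum_succ_sub, leading_factor, riseRatio, riseRatio]
  field_simp

/-- Closed form of the truncated sum at `b = -1/2` for `N = 2m + 1` terms. -/
theorem truncSum_neg_half (m : ℕ) (hm : 1 ≤ m) :
    truncSum (2 * m + 1) (-(1 / 2) : K) =
      (2 * m + 1) * riseRatio (2 * m) (2 * (m : K) + 1) *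
        (riseRatio (2 * m) (-(2 * m + 1) / 2 : K) ^ 2 +
          2 * ∑ y ∈ Ico 1 m, riseRatio (2 * m) (y - (2 * m + 1) / 2 : K) ^ 2) := by
  have key : ∀ k : ℕ, truncSum (2 * m + 1) ((k : K) + 1 - (2 * m + 1) / 2) =
      (2 * m + 1) * riseRatio (2 * m) (2 * (m : K) + 1) *
        (riseRatio (2 * m) (-(2 * m + 1) / 2 : K) ^ 2 +
          2 * ∑ y ∈ Ico 1 (k + 1), riseRatio (2 * m) (y - (2 * m + 1) / 2 : K) ^ 2) := by
    intro k
    induction k with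
    | zero =>
      have h1 := truncSum_succ_sub_riseRatio (2 * m) (-(2 * m + 1) / 2 : K)
      have h2 := truncSum_antisymm (2 * m) (-(2 * m + 1) / 2 : K)
      have e : -((2 * m : ℕ) : K) - -(2 * m + 1) / 2 = -(2 * m + 1) / 2 + 1 := by
        push_cast; ring
      have e' : ((0 : ℕ) : K) + 1 - (2 * m + 1) / 2 = -(2 * m + 1) / 2 + 1 := by
        push_cast; ring
      rw [e] at h2
      rw [e']
      push_cast at h1
      simp only [zero_add, Ico_self, sum_empty, mul_zero, add_zero]
      linear_combination (h1 + h2) / 2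
    | succ k ih =>
      have h1 := truncSum_succ_sub_riseRatio (2 * m) ((k : K) + 1 - (2 * m + 1) / 2)
      have e : (k : K) + 1 - (2 * m + 1) / 2 + 1 = ((k + 1 : ℕ) : K) + 1 - (2 * m + 1) / 2 := by
        push_cast; ring
      rw [e] at h1
      rw [sum_Ico_succ_top (by omega)]
      push_cast at h1 ih ⊢
      linear_combination h1 + ih
  obtain ⟨k, rfl⟩ : ∃ k, m = k + 1 := ⟨m - 1, by omega⟩
  rw [← key]
  congr 1
  push_cast
  ring

end ExactEvaluation

@[to_additive]
lemma prod_Ico_fold {M : Type*} [CommMonoid M] (m : ℕ) (f : ℕ → M) :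
    ∏ t ∈ Ico 1 (2 * m + 1), f t = ∏ t ∈ Ico 1 (m + 1), f t * f (2 * m + 1 - t) := by
  rw [prod_mul_distrib, ← prod_Ico_consecutive f (show 1 ≤ m + 1 by omega)
    (show m + 1 ≤ 2 * m + 1 by omega)]
  congr 1
  refine prod_nbij' (fun t => 2 * m + 1 - t) (fun t => 2 * m + 1 - t) ?_ ?_ ?_ ?_ ?_ <;>
    intro t ht <;> rw [mem_Ico] at ht
  · rw [mem_Ico]; omega
  · rw [mem_Ico]; omega
  · omega
  · omega
  · congr 1; omega

lemma riseRatio_eq_prod {K : Type*} [Field K] [CharZero K] (n : ℕ) (b : K) :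
    riseRatio n b = ∏ t ∈ Ico 1 (n + 1), (1 + b / t) := by
  induction n with
  | zero => simp [riseRatio, rise]
  | succ n ih =>
    have h1 : (n.factorial : K) ≠ 0 := Nat.cast_ne_zero.2 n.factorial_ne_zero
    have h2 : (n : K) + 1 ≠ 0 := n.cast_add_one_ne_zero
    rw [prod_Ico_succ_top (by omega), ← ih, riseRatio, riseRatio, rise_succ, Nat.factorial_succ]
    push_cast
    field_simp
    ring

lemma riseRatio_eq_prod_half {K : Type*} [Field K] [CharZero K] (m : ℕ) (b : K) :
    riseRatio (2 * m) b = ∏ t ∈ Ico 1 (m + 1),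
      (1 + b * (b + (2 * m + 1 : ℕ)) / (t * (2 * m + 1 - t : ℕ))) := by
  rw [riseRatio_eq_prod, prod_Ico_fold]
  refine prod_congr rfl fun t ht => ?_
  rw [mem_Ico] at ht
  have h1 : (t : K) ≠ 0 := Nat.cast_ne_zero.2 (by omega)
  have h2 : ((2 * m + 1 - t : ℕ) : K) ≠ 0 := Nat.cast_ne_zero.2 (by omega)
  have h3 : ((2 * m + 1 : ℕ) : K) = t + (2 * m + 1 - t : ℕ) := by
    rw [← Nat.cast_add]; congr 1; omega
  rw [h3]
  field_simp
  ring

section Padic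

variable {p : ℕ} [hp : Fact p.Prime]

/-- `x` lies in `pⁿ ℤ_p`. -/
def PowDvd (p : ℕ) [Fact p.Prime] (n : ℕ) (x : ℚ_[p]) : Prop := ∃ z : ℤ_[p], x = (p : ℚ_[p]) ^ n * z

namespace PowDvd

variable {m n : ℕ} {x y : ℚ_[p]}

lemma zero : PowDvd p n (0 : ℚ_[p]) := ⟨0, by simp⟩

lemma natCast (k : ℕ) : PowDvd p 0 (k : ℚ_[p]) := ⟨k, by simp⟩

lemma add (hx : PowDvd p n x) (hy : PowDvd p n y) : PowDvd p n (x + y) := by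
  obtain ⟨a, rfl⟩ := hx
  obtain ⟨b, rfl⟩ := hy
  exact ⟨a + b, by push_cast; ring⟩

lemma neg (hx : PowDvd p n x) : PowDvd p n (-x) := by
  obtain ⟨a, rfl⟩ := hx
  exact ⟨-a, by push_cast; ring⟩

lemma sub (hx : PowDvd p n x) (hy : PowDvd p n y) : PowDvd p n (x - y) := by
  rw [sub_eq_add_neg]; exact hx.add hy.neg

lemma mul (hx : PowDvd p m x) (hy : PowDvd p n y) : PowDvd p (m + n) (x * y) := by
  obtain ⟨a, rfl⟩ := hx
  obtain ⟨b, rfl⟩ := hy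
  exact ⟨a * b, by push_cast; ring⟩

lemma mono (h : m ≤ n) (hx : PowDvd p n x) : PowDvd p m x := by
  obtain ⟨a, rfl⟩ := hx
  obtain ⟨k, rfl⟩ := Nat.exists_eq_add_of_le h
  exact ⟨p ^ k * a, by push_cast; ring⟩

lemma mul_left (hx : PowDvd p 0 x) (hy : PowDvd p n y) : PowDvd p n (x * y) :=
  (hx.mul hy).mono (by omega)

lemma pow_self (n : ℕ) : PowDvd p n ((p : ℚ_[p]) ^ n) := ⟨1, by simp⟩

lemma sum {ι : Type*} {s : Finset ι} {f : ι → ℚ_[p]} (h : ∀ i ∈ s, PowDvd p n (f i)) :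
    PowDvd p n (∑ i ∈ s, f i) :=
  sum_induction f (PowDvd p n) (fun _ _ => add) zero h

lemma zero_iff_norm : PowDvd p 0 x ↔ ‖x‖ ≤ 1 := by
  refine ⟨?_, fun h => ⟨⟨x, h⟩, by simp⟩⟩
  rintro ⟨z, rfl⟩
  simpa using z.2

lemma norm_le (hx : PowDvd p n x) : ‖x‖ ≤ (p : ℝ) ^ (-n : ℤ) := by
  obtain ⟨z, rfl⟩ := hx
  rw [norm_mul, Padic.norm_p_pow]
  exact mul_le_of_le_one_right (by positivity) z.2

lemma inv_natCast {k : ℕ} (hk : p.Coprime k) : PowDvd p 0 ((k : ℚ_[p])⁻¹) := by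
  rw [zero_iff_norm, norm_inv, Padic.norm_natCast_eq_one_iff.2 hk, inv_one]

lemma inv_one_sub (hx : PowDvd p 1 x) : PowDvd p 0 ((1 - x)⁻¹) := by
  have h1 : ‖x‖ < 1 := by
    refine hx.norm_le.trans_lt ?_
    have : (1 : ℝ) < p := by exact_mod_cast hp.out.one_lt
    simpa using inv_lt_one_of_one_lt₀ this
  have h2 : ‖(1 : ℚ_[p]) - x‖ = 1 := by
    rw [sub_eq_add_neg, Padic.add_eq_max_of_ne (by rw [norm_neg, norm_one]; exact h1.ne')]
    rw [norm_neg, norm_one, max_eq_left h1.le]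
  rw [zero_iff_norm, norm_inv, h2, inv_one]

lemma prod {ι : Type*} {s : Finset ι} {f : ι → ℚ_[p]} (h : ∀ i ∈ s, PowDvd p 0 (f i)) :
    PowDvd p 0 (∏ i ∈ s, f i) :=
  prod_induction f (PowDvd p 0) (fun _ _ => mul_left) ⟨1, by simp⟩ h

lemma prod_sub_prod {ι : Type*} {s : Finset ι} {f g : ι → ℚ_[p]}
    (hf : ∀ i ∈ s, PowDvd p 0 (f i)) (hg : ∀ i ∈ s, PowDvd p 0 (g i))
    (h : ∀ i ∈ s, PowDvd p n (f i - g i)) : PowDvd p n (∏ i ∈ s, f i - ∏ i ∈ s, g i) := by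
  classical
  induction s using Finset.induction_on with
  | empty => simpa using zero
  | insert a s ha ih =>
    rw [prod_insert ha, prod_insert ha]
    have e : f a * ∏ i ∈ s, f i - g a * ∏ i ∈ s, g i =
        f a * (∏ i ∈ s, f i - ∏ i ∈ s, g i) + (∏ i ∈ s, g i) * (f a - g a) := by ring
    rw [e]
    exact (mul_left (hf a (mem_insert_self a s)) (ih (fun i hi => hf i (mem_insert_of_mem hi))
      (fun i hi => hg i (mem_insert_of_mem hi)) (fun i hi => h i (mem_insert_of_mem hi)))).add
      (mul_left (prod fun i hi => hg i (mem_insert_of_mem hi)) (h a (mem_insert_self a s)))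

lemma prod_one_add_sub {ι : Type*} {s : Finset ι} {f : ι → ℚ_[p]}
    (h : ∀ i ∈ s, PowDvd p n (f i)) :
    PowDvd p (n + n) (∏ i ∈ s, (1 + f i) - (1 + ∑ i ∈ s, f i)) := by
  classical
  induction s using Finset.induction_on with
  | empty => simpa using zero
  | insert a s ha ih =>
    rw [prod_insert ha, sum_insert ha]
    have hs : ∀ i ∈ s, PowDvd p n (f i) := fun i hi => h i (mem_insert_of_mem hi)
    have ha' := h a (mem_insert_self a s)
    have e : (1 + f a) * ∏ i ∈ s, (1 + f i) - (1 + (f a + ∑ i ∈ s, f i)) =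
        (1 + f a) * (∏ i ∈ s, (1 + f i) - (1 + ∑ i ∈ s, f i)) + f a * ∑ i ∈ s, f i := by ring
    rw [e]
    have h1 : PowDvd p 0 (1 + f a) := by
      simpa using (natCast (p := p) 1).add (ha'.mono n.zero_le)
    exact (mul_left h1 (ih hs)).add (ha'.mul (sum hs))

end PowDvd

lemma powDvd_pow_div {r i : ℕ} (hi : ¬ p ^ r ∣ i) : PowDvd p 1 ((p : ℚ_[p]) ^ r / i) := by
  have hi0 : i ≠ 0 := by rintro rfl; exact hi (dvd_zero _)
  obtain ⟨s, u, hu, rfl⟩ := Nat.exists_eq_pow_mul_and_not_dvd hi0 p hp.out.ne_one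
  have hs : s < r := by
    by_contra! h
    exact hi (Dvd.dvd.mul_right (pow_dvd_pow p h) u)
  obtain ⟨k, rfl⟩ : ∃ k, r = s + k + 1 := ⟨r - s - 1, by omega⟩
  have hp0 : (p : ℚ_[p]) ≠ 0 := Nat.cast_ne_zero.2 hp.out.ne_zero
  have e : (p : ℚ_[p]) ^ (s + k + 1) / ((p ^ s * u : ℕ) : ℚ_[p]) = (u : ℚ_[p])⁻¹ * p ^ (k + 1) := by
    push_cast
    rw [show s + k + 1 = s + (k + 1) by ring, pow_add, mul_div_mul_left _ _ (pow_ne_zero _ hp0)]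
    ring
  rw [e]
  exact (PowDvd.mul_left (.inv_natCast ((hp.out.coprime_iff_not_dvd).2 hu))
    (.pow_self _)).mono (by omega)

lemma powDvd_pow_div_of_lt {r i : ℕ} (h0 : 0 < i) (h1 : i < p ^ r) :
    PowDvd p 1 ((p : ℚ_[p]) ^ r / i) :=
  powDvd_pow_div (Nat.not_dvd_of_pos_of_lt h0 h1)

lemma zmod_sum_inv_sq (h3 : 3 < p) (h : ℕ) (hh : 2 * h + 1 = p) :
    ∑ i ∈ Ico 1 (h + 1), ((i : ZMod p)⁻¹) ^ 2 = 0 := by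
  have hall : ∑ x : ZMod p, (x⁻¹) ^ 2 = 0 := by
    rw [← FiniteField.sum_pow_lt_card_sub_one (ZMod p) 2 (by rw [ZMod.card]; omega)]
    exact (inv_involutive (G := ZMod p)).bijective.sum_comp (fun x => x ^ 2)
  have hr : ∑ x : ZMod p, (x⁻¹) ^ 2 = ∑ i ∈ range p, ((i : ZMod p)⁻¹) ^ 2 := by
    refine (sum_nbij' (fun i : ℕ => (i : ZMod p)) ZMod.val ?_ ?_ ?_ ?_ ?_).symm
    · simp
    · exact fun x _ => mem_range.2 x.val_lt
    · exact fun i hi => ZMod.val_cast_of_lt (mem_range.1 hi)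
    · simp
    · simp
  have hfold := sum_Ico_fold h fun i => ((i : ZMod p)⁻¹) ^ 2
  rw [hr, range_eq_Ico, sum_eq_sum_Ico_succ_bot hp.out.pos, zero_add] at hall
  rw [hh] at hfold
  rw [hfold] at hall
  have hdup : ∀ i ∈ Ico 1 (h + 1), ((i : ZMod p)⁻¹) ^ 2 + (((p - i : ℕ) : ZMod p)⁻¹) ^ 2 =
      2 * ((i : ZMod p)⁻¹) ^ 2 := by
    intro i hi
    rw [mem_Ico] at hi
    rw [Nat.cast_sub (by omega), ZMod.natCast_self, zero_sub, inv_neg, neg_sq]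
    ring
  rw [sum_congr rfl hdup, ← mul_sum] at hall
  have h2 : (2 : ZMod p) ≠ 0 := by
    intro h2
    have : ((2 : ℕ) : ZMod p) = 0 := by exact_mod_cast h2
    rw [ZMod.natCast_eq_zero_iff] at this
    exact absurd (Nat.le_of_dvd (by norm_num) this) (by omega)
  simpa [h2] using hall

lemma powDvd_sum_inv_sq (h3 : 3 < p) (h : ℕ) (hh : 2 * h + 1 = p) :
    PowDvd p 1 (∑ i ∈ Ico 1 (h + 1), ((i : ℚ_[p])⁻¹) ^ 2) := by
  have hunit : ∀ i ∈ Ico 1 (h + 1), ‖(i : ℤ_[p])‖ = 1 := by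
    intro i hi
    rw [mem_Ico] at hi
    rw [PadicInt.norm_def, PadicInt.coe_natCast, Padic.norm_natCast_eq_one_iff]
    exact (hp.out.coprime_iff_not_dvd).2 (Nat.not_dvd_of_pos_of_lt (by omega) (by omega))
  have hzero : PadicInt.toZMod (∑ i ∈ Ico 1 (h + 1), ((i : ℤ_[p]).inv) ^ 2) = 0 := by
    rw [map_sum, ← zmod_sum_inv_sq h3 h hh]
    refine sum_congr rfl fun i hi => ?_
    have := congrArg PadicInt.toZMod (PadicInt.mul_inv (hunit i hi))
    rw [map_mul, map_natCast, map_one] at this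
    rw [map_pow, eq_inv_of_mul_eq_one_right this]
  rw [← RingHom.mem_ker, PadicInt.ker_toZMod, PadicInt.maximalIdeal_eq_span_p,
    Ideal.mem_span_singleton] at hzero
  obtain ⟨z, hz⟩ := hzero
  refine ⟨z, ?_⟩
  have hz' := congrArg (fun x : ℤ_[p] => (x : ℚ_[p])) hz
  simp only [PadicInt.coe_mul, PadicInt.coe_natCast, PadicInt.coe_sum, PadicInt.coe_pow] at hz'
  rw [pow_one, ← hz']
  refine sum_congr rfl fun i hi => ?_
  have := congrArg (fun x : ℤ_[p] => (x : ℚ_[p])) (PadicInt.mul_inv (hunit i hi))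
  simp only [PadicInt.coe_mul, PadicInt.coe_natCast, PadicInt.coe_one] at this
  rw [eq_inv_of_mul_eq_one_right this]

/-- A Wolstenholme-type congruence for prime powers. -/
lemma powDvd_sum_pow_div_sq (h3 : 3 < p) (r m : ℕ) (hm : 2 * m + 1 = p ^ (r + 1)) :
    PowDvd p 3 (∑ i ∈ Ico 1 (m + 1), ((p : ℚ_[p]) ^ (r + 1) / i) ^ 2) := by
  induction r generalizing m with
  | zero =>
    have e : ∀ i ∈ Ico 1 (m + 1), ((p : ℚ_[p]) ^ (0 + 1) / i) ^ 2 =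
        (p : ℚ_[p]) ^ 2 * ((i : ℚ_[p])⁻¹) ^ 2 := fun i _ => by ring
    rw [sum_congr rfl e, ← mul_sum]
    exact (PowDvd.pow_self 2).mul (powDvd_sum_inv_sq h3 m (by simpa using hm))
  | succ r ih =>
    have hp0 : (p : ℚ_[p]) ≠ 0 := Nat.cast_ne_zero.2 hp.out.ne_zero
    have hodd : Odd (p ^ (r + 1)) := (hp.out.odd_of_ne_two (by omega)).pow
    obtain ⟨m', hm'⟩ := hodd
    have hmm : 2 * m + 1 = p * (2 * m' + 1) := by rw [hm, ← hm']; ring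
    rw [← sum_filter_add_sum_filter_not _ (fun i => p ∣ i)]
    refine PowDvd.add ?_ (PowDvd.sum fun i hi => ?_)
    · have himg : (Ico 1 (m + 1)).filter (fun i => p ∣ i) = (Ico 1 (m' + 1)).image (p * ·) := by
        ext i
        simp only [mem_filter, mem_Ico, mem_image]
        constructor
        · rintro ⟨hi, j, rfl⟩
          refine ⟨j, ⟨Nat.pos_of_mul_pos_left (a := p) (by omega), ?_⟩, rfl⟩
          by_contra! hj
          have := Nat.mul_le_mul_left p hj
          nlinarith
        · rintro ⟨j, ⟨hj, hj'⟩, rfl⟩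
          have := Nat.mul_le_mul_left p (show j ≤ m' by omega)
          have h1 := Nat.mul_pos hp.out.pos hj
          exact ⟨⟨h1, by nlinarith⟩, dvd_mul_right _ _⟩
      rw [himg, sum_image fun a _ b _ hab => Nat.eq_of_mul_eq_mul_left hp.out.pos hab]
      convert ih m' hm'.symm using 2 with i
      push_cast
      rw [pow_succ' _ (r + 1), mul_div_mul_left _ _ hp0]
    · rw [mem_filter] at hi
      have h1 := PowDvd.mul_left (.inv_natCast ((hp.out.coprime_iff_not_dvd).2 hi.2))
        (PowDvd.pow_self (p := p) (r + 1 + 1))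
      rw [div_eq_inv_mul, sq]
      exact (h1.mul h1).mono (by omega)

lemma powDvd_riseRatio_sub_one (h3 : 3 < p) {r m : ℕ} (hm : 2 * m + 1 = p ^ (r + 1))
    {β : ℚ_[p]} (hβ : PowDvd p 0 β) :
    PowDvd p 3 (riseRatio (2 * m) (β * (p : ℚ_[p]) ^ (r + 1)) - 1) := by
  set N : ℚ_[p] := (p : ℚ_[p]) ^ (r + 1) with hN
  set c := β * (β + 1) with hc_def
  have hc : PowDvd p 0 c := hβ.mul_left (hβ.add (by simpa using PowDvd.natCast (p := p) 1))
  have hNat : ((2 * m + 1 : ℕ) : ℚ_[p]) = N := by rw [hm, hN]; push_cast; rfl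
  set f : ℕ → ℚ_[p] := fun t => c * ((N / t) * (N / (2 * m + 1 - t : ℕ))) with hf
  have hprod : riseRatio (2 * m) (β * N) = ∏ t ∈ Ico 1 (m + 1), (1 + f t) := by
    rw [riseRatio_eq_prod_half, hNat]
    refine prod_congr rfl fun t _ => ?_
    rw [hf, hc_def]
    ring
  have hd : ∀ t ∈ Ico 1 (m + 1), PowDvd p 1 (N / t) ∧ PowDvd p 1 (N / (2 * m + 1 - t : ℕ)) := by
    intro t ht
    rw [mem_Ico] at ht
    exact ⟨powDvd_pow_div_of_lt (by omega) (by omega),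
      powDvd_pow_div_of_lt (by omega) (by omega)⟩
  have h1 := PowDvd.prod_one_add_sub (n := 2) (s := Ico 1 (m + 1)) (f := f) fun t ht =>
    hc.mul_left ((hd t ht).1.mul (hd t ht).2)
  have h2 : PowDvd p 3 (∑ t ∈ Ico 1 (m + 1), f t) := by
    have e : ∑ t ∈ Ico 1 (m + 1), f t = ∑ t ∈ Ico 1 (m + 1), (f t + c * (N / t) ^ 2) -
        c * ∑ t ∈ Ico 1 (m + 1), (N / t) ^ 2 := by
      rw [sum_add_distrib, mul_sum, add_sub_cancel_right]
    rw [e]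
    refine (PowDvd.sum fun t ht => ?_).sub (hc.mul_left (powDvd_sum_pow_div_sq h3 r m hm))
    have e' : f t + c * (N / t) ^ 2 = c * (N / t * (N / t) * (N / (2 * m + 1 - t : ℕ))) := by
      rw [mem_Ico] at ht
      have h1 : (t : ℚ_[p]) ≠ 0 := Nat.cast_ne_zero.2 (by omega)
      have h2 : ((2 * m + 1 - t : ℕ) : ℚ_[p]) ≠ 0 := Nat.cast_ne_zero.2 (by omega)
      have h3 : N = t + (2 * m + 1 - t : ℕ) := by
        rw [← hNat, ← Nat.cast_add]; congr 1; omega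
      have h4 : N / t + N / (2 * m + 1 - t : ℕ) = N / t * (N / (2 * m + 1 - t : ℕ)) := by
        rw [div_add_div _ _ h1 h2, div_mul_div_comm]
        congr 1
        linear_combination -N * h3
      rw [hf]
      linear_combination c * (N / t) * h4
    rw [e']
    exact hc.mul_left (((hd t ht).1.mul (hd t ht).1).mul (hd t ht).2)
  rw [hprod]
  have := (h1.mono (m := 3) (by omega)).add h2
  convert this using 1
  ring

lemma choose_prime_pow_modEq (r n : ℕ) : n.choose (p ^ r) ≡ n / p ^ r [MOD p] := by
  induction r generalizing n with
  | zero => simpa using Nat.ModEq.refl _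
  | succ r ih =>
    refine Choose.choose_modEq_choose_mod_mul_choose_div_nat.trans ?_
    rw [pow_succ', Nat.mul_mod_right, Nat.mul_div_cancel_left _ hp.out.pos, Nat.choose_zero_right,
      one_mul, ← Nat.div_div_eq_div_mul]
    exact ih _

lemma powDvd_natCast_sub {a b : ℕ} (h : a ≡ b [MOD p]) :
    PowDvd p 1 ((a : ℚ_[p]) - b) := by
  obtain ⟨c, hc⟩ := (Nat.modEq_iff_dvd.1 h)
  refine ⟨-c, ?_⟩
  have : ((b : ℤ) : ℚ_[p]) - (a : ℤ) = p * c := by exact_mod_cast congrArg (Int.cast (R := ℚ_[p])) hc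
  push_cast at this ⊢
  linear_combination -this

lemma powDvd_half (h3 : 3 < p) : PowDvd p 0 (1 / 2 : ℚ_[p]) := by
  have := PowDvd.inv_natCast (p := p) (k := 2)
    ((hp.out.coprime_iff_not_dvd).2 (Nat.not_dvd_of_pos_of_lt (by norm_num) (by omega)))
  simpa using this

/-- `C(y - 1 + N/2, N) ≡ 1/2 (mod p)` for `N = p ^ r` and `1 ≤ y ≤ N`. -/
lemma powDvd_rise_div_factorial (h3 : 3 < p) {r y : ℕ} (hy : 1 ≤ y) (hy' : y ≤ p ^ r) :
    PowDvd p 1 (rise ((y : ℚ_[p]) - p ^ r / 2) (p ^ r) / (p ^ r).factorial - 1 / 2) := by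
  have hhalf := powDvd_half h3
  set N := p ^ r with hN
  obtain ⟨v, u, hu, hvu⟩ :=
    Nat.exists_eq_pow_mul_and_not_dvd N.factorial_ne_zero p hp.out.ne_one
  have hodd : Odd (p ^ (v + 1)) := (hp.out.odd_of_ne_two (by omega)).pow
  obtain ⟨t', ht'⟩ := hodd
  have hNc : (p : ℚ_[p]) ^ r = (N : ℚ_[p]) := by rw [hN]; push_cast; rfl
  have htc : (p : ℚ_[p]) ^ (v + 1) = 2 * t' + 1 := by exact_mod_cast ht'
  obtain ⟨y', rfl⟩ : ∃ y', y = y' + 1 := ⟨y - 1, by omega⟩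
  have hu0 : (u : ℚ_[p]) ≠ 0 := Nat.cast_ne_zero.2 (by rintro rfl; exact hu (dvd_zero _))
  have hp0 : (p : ℚ_[p]) ≠ 0 := Nat.cast_ne_zero.2 hp.out.ne_zero
  have hf0 : (N.factorial : ℚ_[p]) ≠ 0 := Nat.cast_ne_zero.2 N.factorial_ne_zero
  rw [hNc]
  set b : ℚ_[p] := ((y' + 1 : ℕ) : ℚ_[p]) - N / 2 with hb
  have hb0 : PowDvd p 0 b := by
    have := (PowDvd.natCast (p := p) (y' + 1)).sub (hhalf.mul_left (PowDvd.natCast (p := p) N))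
    convert this using 1
    rw [hb]; ring
  set k := y' + N * t' with hk
  have hchoose : rise ((k : ℚ_[p]) + 1) N / N.factorial = ((k + N).choose N : ℕ) := by
    have h1 := rise_natCast_add_one (K := ℚ_[p]) N k
    have h2 : (k + N).choose N * N.factorial * k.factorial = (k + N).factorial := by
      have := Nat.choose_mul_factorial_mul_factorial (Nat.le_add_left N k)
      rwa [Nat.add_sub_cancel] at this
    have hk0 : (k.factorial : ℚ_[p]) ≠ 0 := Nat.cast_ne_zero.2 k.factorial_ne_zero
    rw [div_eq_iff hf0]
    apply mul_right_cancel₀ hk0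
    rw [h1, ← h2]
    push_cast
    rfl
  have hluc : PowDvd p 1 (((k + N).choose N : ℕ) - ((t' + 1 : ℕ) : ℚ_[p])) := by
    refine powDvd_natCast_sub ((choose_prime_pow_modEq r (k + N)).trans ?_)
    rw [← hN, hk, show y' + N * t' + N = y' + N * (t' + 1) by ring,
      Nat.add_mul_div_left _ _ (by omega), Nat.div_eq_of_lt (by omega), zero_add]
  have hdiff : PowDvd p (v + 1) (rise b N - rise ((k : ℚ_[p]) + 1) N) := by
    refine PowDvd.prod_sub_prod (fun i _ => hb0.add (.natCast i)) (fun i _ => ?_) (fun i _ => ?_)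
    · have := PowDvd.natCast (p := p) (k + 1 + i)
      push_cast at this
      exact this
    · have e : b + i - (k + 1 + i) = -(1 / 2 * N) * (p : ℚ_[p]) ^ (v + 1) := by
        rw [htc, hb, hk]; push_cast; ring
      rw [e]
      exact PowDvd.mul_left (hhalf.mul_left (.natCast N)).neg (.pow_self _)
  have hdiff' : PowDvd p 1 ((rise b N - rise ((k : ℚ_[p]) + 1) N) / N.factorial) := by
    obtain ⟨z, hz⟩ := hdiff
    have e : (rise b N - rise ((k : ℚ_[p]) + 1) N) / N.factorial =
        (u : ℚ_[p])⁻¹ * (p ^ 1 * z) := by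
      rw [hz, hvu]
      push_cast
      field_simp
      ring
    rw [e]
    exact PowDvd.mul_left (.inv_natCast ((hp.out.coprime_iff_not_dvd).2 hu)) ⟨z, rfl⟩
  have ht : PowDvd p 1 (((t' + 1 : ℕ) : ℚ_[p]) - 1 / 2) := by
    have e : ((t' + 1 : ℕ) : ℚ_[p]) - 1 / 2 = 1 / 2 * (p : ℚ_[p]) ^ (v + 1) := by
      rw [htc]; push_cast; ring
    rw [e]
    exact (hhalf.mul_left (.pow_self _)).mono (by omega)
  have := (hdiff'.add hluc).add ht
  convert this using 1
  rw [← hchoose]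
  ring

lemma riseRatio_approx (h3 : 3 < p) {r m y : ℕ} (hm : 2 * m + 1 = p ^ r) (hy : 1 ≤ y)
    (hy' : y ≤ m) :
    ∃ B : ℚ_[p], PowDvd p 1 (B - 1 / 2) ∧
      riseRatio (2 * m) ((y : ℚ_[p]) - p ^ r / 2) =
        (1 - 1 / 2 * ((p : ℚ_[p]) ^ r / y))⁻¹ * (B * ((p : ℚ_[p]) ^ r / y)) := by
  refine ⟨_, powDvd_rise_div_factorial (r := r) h3 hy (by omega), ?_⟩
  have hNc : (p : ℚ_[p]) ^ r = ((2 * m + 1 : ℕ) : ℚ_[p]) := by rw [hm]; push_cast; rfl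
  have hne : ((2 * y : ℕ) : ℚ_[p]) ≠ (2 * m + 1 : ℕ) := by
    rw [Ne, Nat.cast_inj]; omega
  have hsub : (y : ℚ_[p]) * 2 - (2 * m + 1 : ℕ) ≠ 0 := by
    intro h; apply hne; push_cast at h ⊢; linear_combination h
  have hy0 : (y : ℚ_[p]) ≠ 0 := Nat.cast_ne_zero.2 (by omega)
  have hf0 : ((2 * m).factorial : ℚ_[p]) ≠ 0 := Nat.cast_ne_zero.2 (2 * m).factorial_ne_zero
  have hN0 : ((2 * m + 1 : ℕ) : ℚ_[p]) ≠ 0 := Nat.cast_ne_zero.2 (by omega)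
  rw [hNc, ← hm, riseRatio, rise_succ_left, Nat.factorial_succ]
  rw [Nat.cast_mul]
  have e : (1 : ℚ_[p]) - 1 / 2 * ((2 * m + 1 : ℕ) / y) = (y * 2 - (2 * m + 1 : ℕ)) / (2 * y) := by
    field_simp
  rw [e]
  generalize ((2 * m + 1 : ℕ) : ℚ_[p]) = N at *
  field_simp

lemma powDvd_riseRatio (h3 : 3 < p) {r m y n : ℕ} (hm : 2 * m + 1 = p ^ r) (hy : 1 ≤ y)
    (hy' : y ≤ m) (hn : PowDvd p n ((p : ℚ_[p]) ^ r / y)) :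
    PowDvd p n (riseRatio (2 * m) ((y : ℚ_[p]) - p ^ r / 2)) := by
  obtain ⟨B, hB, hP⟩ := riseRatio_approx h3 hm hy hy'
  have hhalf := powDvd_half h3
  have hB0 : PowDvd p 0 B := by simpa using (hB.mono (m := 0) (by omega)).add hhalf
  have hq : PowDvd p 1 ((p : ℚ_[p]) ^ r / y) := powDvd_pow_div_of_lt (by omega) (by omega)
  rw [hP]
  exact PowDvd.mul_left (PowDvd.inv_one_sub (hhalf.mul_left hq)) (hB0.mul_left hn)

lemma powDvd_riseRatio_sq_sub (h3 : 3 < p) {r m y : ℕ} (hm : 2 * m + 1 = p ^ r) (hy : 1 ≤ y)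
    (hy' : y ≤ m) :
    PowDvd p 3 (riseRatio (2 * m) ((y : ℚ_[p]) - p ^ r / 2) ^ 2 -
      1 / 2 * (1 / 2) * ((p : ℚ_[p]) ^ r / y) ^ 2) := by
  obtain ⟨B, hB, hP⟩ := riseRatio_approx h3 hm hy hy'
  have hhalf := powDvd_half h3
  have hq : PowDvd p 1 ((p : ℚ_[p]) ^ r / y) := powDvd_pow_div_of_lt (by omega) (by omega)
  have hPd := powDvd_riseRatio h3 hm hy hy' hq
  set P := riseRatio (2 * m) ((y : ℚ_[p]) - p ^ r / 2)
  set q := (p : ℚ_[p]) ^ r / y with hq_def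
  have hne : 1 - 1 / 2 * q ≠ 0 := by
    have hy0 : (y : ℚ_[p]) ≠ 0 := Nat.cast_ne_zero.2 (by omega)
    have hNc : (p : ℚ_[p]) ^ r = ((2 * m + 1 : ℕ) : ℚ_[p]) := by rw [hm]; push_cast; rfl
    intro h
    have h' : ((2 * y : ℕ) : ℚ_[p]) = (2 * m + 1 : ℕ) := by
      rw [hq_def, hNc] at h
      field_simp at h
      push_cast at h ⊢
      linear_combination h
    have := Nat.cast_injective h'
    omega
  have hlin : P - 1 / 2 * q = (1 / 2 * q) * P + q * (B - 1 / 2) := by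
    have : (1 - 1 / 2 * q) * P = B * q := by rw [hP, mul_inv_cancel_left₀ hne]
    linear_combination this
  have hE : PowDvd p 2 (P - 1 / 2 * q) := by
    rw [hlin]
    exact ((hhalf.mul_left hq).mul hPd).add (hq.mul hB)
  have e : P ^ 2 - 1 / 2 * (1 / 2) * q ^ 2 = (P - 1 / 2 * q) * (P + 1 / 2 * q) := by ring
  rw [e]
  exact hE.mul (hPd.add (hhalf.mul_left hq))

lemma powDvd_sum_riseRatio_sq (h3 : 3 < p) {r m : ℕ} (hr : 1 ≤ r)
    (hm : 2 * m + 1 = p ^ (r + 1)) (hm1 : 1 ≤ m) :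
    PowDvd p 3 (∑ y ∈ Ico 1 m, riseRatio (2 * m) ((y : ℚ_[p]) - p ^ (r + 1) / 2) ^ 2) := by
  have hhalf := powDvd_half h3
  have hfull : PowDvd p 3
      (∑ y ∈ Ico 1 (m + 1), riseRatio (2 * m) ((y : ℚ_[p]) - p ^ (r + 1) / 2) ^ 2) := by
    have h1 := (hhalf.mul_left hhalf).mul_left (powDvd_sum_pow_div_sq h3 r m hm)
    have h2 : PowDvd p 3 (∑ y ∈ Ico 1 (m + 1),
        (riseRatio (2 * m) ((y : ℚ_[p]) - p ^ (r + 1) / 2) ^ 2 -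
          1 / 2 * (1 / 2) * ((p : ℚ_[p]) ^ (r + 1) / y) ^ 2)) :=
      PowDvd.sum fun y hy => by
        rw [mem_Ico] at hy
        exact powDvd_riseRatio_sq_sub h3 hm hy.1 (by omega)
    rw [sum_sub_distrib, ← mul_sum] at h2
    simpa using h2.add h1
  have hcop : p.Coprime m := by
    refine (hp.out.coprime_iff_not_dvd).2 fun h => hp.out.one_lt.ne' ?_
    have h2 : p ∣ 2 * m + 1 := by rw [hm]; exact dvd_pow_self p (by omega)
    exact Nat.dvd_one.1 ((Nat.dvd_add_right (h.mul_left 2)).1 h2)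
  have hlast : PowDvd p (r + 1) (riseRatio (2 * m) ((m : ℚ_[p]) - p ^ (r + 1) / 2)) := by
    refine powDvd_riseRatio h3 hm hm1 le_rfl ?_
    rw [div_eq_inv_mul]
    exact PowDvd.mul_left (.inv_natCast hcop) (.pow_self _)
  rw [sum_Ico_succ_top hm1, sq (riseRatio (2 * m) ((m : ℚ_[p]) - _))] at hfull
  simpa using hfull.sub ((hlast.mul hlast).mono (m := 3) (by omega))

lemma powDvd_truncSum_sub (h3 : 3 < p) {r : ℕ} (hr : 1 ≤ r) :
    PowDvd p (r + 1 + 3) (truncSum (p ^ (r + 1)) (-(1 / 2) : ℚ_[p]) - (p : ℚ_[p]) ^ (r + 1)) := by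
  have hhalf := powDvd_half h3
  obtain ⟨m, hm⟩ : Odd (p ^ (r + 1)) := (hp.out.odd_of_ne_two (by omega)).pow
  have hm1 : 1 ≤ m := by
    have := Nat.le_self_pow (show r + 1 ≠ 0 by omega) p
    omega
  have hNc : 2 * (m : ℚ_[p]) + 1 = (p : ℚ_[p]) ^ (r + 1) := by exact_mod_cast hm.symm
  have h1 : PowDvd p 0 (1 : ℚ_[p]) := by simpa using PowDvd.natCast (p := p) 1
  have h2 : PowDvd p 0 (2 : ℚ_[p]) := by simpa using PowDvd.natCast (p := p) 2
  have hC := powDvd_riseRatio_sub_one h3 hm.symm h1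
  have hP := powDvd_riseRatio_sub_one h3 hm.symm hhalf.neg
  have hS := powDvd_sum_riseRatio_sq h3 hr hm.symm hm1
  rw [one_mul] at hC
  rw [hm, truncSum_neg_half m hm1, hNc,
    show -(p : ℚ_[p]) ^ (r + 1) / 2 = -(1 / 2) * (p : ℚ_[p]) ^ (r + 1) by ring]
  set C := riseRatio (2 * m) ((p : ℚ_[p]) ^ (r + 1))
  set P := riseRatio (2 * m) (-(1 / 2) * (p : ℚ_[p]) ^ (r + 1))
  set S := ∑ y ∈ Ico 1 m, riseRatio (2 * m) ((y : ℚ_[p]) - p ^ (r + 1) / 2) ^ 2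
  have hC0 : PowDvd p 0 C := by simpa using (hC.mono (m := 0) (by omega)).add h1
  have hP0 : PowDvd p 0 (P + 1) := by
    have := (hP.mono (m := 0) (by omega)).add h2
    convert this using 1
    ring
  have e : (p : ℚ_[p]) ^ (r + 1) * C * (P ^ 2 + 2 * S) - (p : ℚ_[p]) ^ (r + 1) =
      (p : ℚ_[p]) ^ (r + 1) * (C * ((P + 1) * (P - 1) + 2 * S) + (C - 1)) := by ring
  rw [e]
  exact (PowDvd.pow_self _).mul
    ((hC0.mul_left ((hP0.mul_left hP).add (h2.mul_left hS))).add hC)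

lemma PowDvd.num_den {n : ℕ} {x : ℚ} (hx : PowDvd p n (x : ℚ_[p])) :
    (p : ℤ) ^ n ∣ x.num ∧ ¬ (p : ℤ) ∣ (x.den : ℤ) := by
  have hmul : (x.num : ℚ_[p]) = x * (x.den : ℚ_[p]) := by
    have := congrArg (fun q : ℚ => (q : ℚ_[p])) (Rat.mul_den_eq_num x)
    push_cast at this
    exact this.symm
  constructor
  · rw [← Padic.norm_int_le_pow_iff_dvd, hmul, mul_comm]
    exact ((PowDvd.natCast x.den).mul_left hx).norm_le
  · intro hd
    have hden : PowDvd p 1 (x.den : ℚ_[p]) := by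
      obtain ⟨c, hc⟩ := Int.natCast_dvd_natCast.1 hd
      exact ⟨c, by rw [hc]; push_cast; ring⟩
    have hnum : (p : ℤ) ^ 1 ∣ x.num := by
      rw [← Padic.norm_int_le_pow_iff_dvd, hmul]
      exact (PowDvd.mul_left (hx.mono n.zero_le) hden).norm_le
    rw [pow_one, Int.natCast_dvd] at hnum
    exact Nat.Prime.not_coprime_iff_dvd.2 ⟨p, hp.out, hnum, Int.natCast_dvd_natCast.1 hd⟩ x.reduced

end Padic

theorem stmt_7 (p : ℕ) (hp : p.Prime) (hp3 : 3 < p) (r : ℕ) (hr : 2 ≤ r) (x : ℚ)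
    (hx : x = (∑ k ∈ Finset.range (p ^ r),
        (3 * (k : ℚ) - 1) *
          (risingRat (1 / 2) k * (risingRat (-1 / 2) k) ^ 2 / ((k.factorial : ℚ)) ^ 3) *
          4 ^ k) -
      (p : ℚ) ^ r) :
    (p : ℤ) ^ (r + 3) ∣ x.num ∧ ¬ (p : ℤ) ∣ (x.den : ℤ) := by
  have : Fact p.Prime := ⟨hp⟩
  obtain ⟨s, rfl⟩ : ∃ s, r = s + 1 := ⟨r - 1, by omega⟩
  apply PowDvd.num_den
  convert powDvd_truncSum_sub (p := p) hp3 (r := s) (by omega) using 1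
  rw [hx, truncSum]
  push_cast [risingRat]
  congr 1
  refine sum_congr rfl fun k _ => ?_
  rw [weight, rise, rise, neg_div]
  ring
end

section
/- Let n > 1 be an odd integer. Then, modulo [n]·Φ_n(q), the following q-congruence of rational functions holds: (q;q^2)_n / ((1-q)·(q;q)_{n-1}) ≡ [n]. -/
open Finset Polynomial

/-- The variable `q`, viewed as a rational function over `ℚ`. -/
noncomputable def q : RatFunc ℚ := RatFunc.X

/-- The q-shifted factorial `(a; b)_n = (1-a)(1-ab)⋯(1-ab^{n-1})`. -/
noncomputable def qpoch (a b : RatFunc ℚ) (n : ℕ) : RatFunc ℚ :=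
  ∏ i ∈ Finset.range n, (1 - a * b ^ i)

/-- The q-integer `[m] = (1-q^m)/(1-q)` (for an arbitrary integer `m`). -/
noncomputable def qint (m : ℤ) : RatFunc ℚ := (1 - q ^ m) / (1 - q)

/-- The q-integer `[n] = 1 + q + ⋯ + q^{n-1}` as a polynomial. -/
noncomputable def qintPoly (n : ℕ) : Polynomial ℚ := ∑ i ∈ Finset.range n, Polynomial.X ^ i

/-- The central q-binomial coefficient `[2k choose k] = (q;q)_{2k}/(q;q)_k^2`. -/
noncomputable def qcb (k : ℕ) : RatFunc ℚ := qpoch q q (2 * k) / (qpoch q q k) ^ 2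

/-- Two rational functions are congruent modulo a polynomial `P` iff `P` divides the
numerator of the reduced form of their difference. -/
def ratCongr (A B : RatFunc ℚ) (P : Polynomial ℚ) : Prop := P ∣ (A - B).num

/-- The polynomial `(X; X)_k = (1 - X)(1 - X ^ 2)⋯(1 - X ^ k)`. -/
noncomputable def qfacPoly (k : ℕ) : ℚ[X] := ∏ i ∈ range k, (1 - X ^ (i + 1))

/-- The polynomial `(-X; X)_k = (1 + X)(1 + X ^ 2)⋯(1 + X ^ k)`. -/
noncomputable def qfacNegPoly (k : ℕ) : ℚ[X] := ∏ i ∈ range k, (1 + X ^ (i + 1))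

lemma qfacPoly_succ (k : ℕ) : qfacPoly (k + 1) = qfacPoly k * (1 - X ^ (k + 1)) :=
  prod_range_succ _ _

lemma one_sub_X_pow_succ_ne_zero (k : ℕ) : (1 - X ^ (k + 1) : ℚ[X]) ≠ 0 := by
  intro h
  simpa using congrArg (eval 0) h

lemma qfacPoly_ne_zero (k : ℕ) : qfacPoly k ≠ 0 :=
  prod_ne_zero_iff.mpr fun i _ => one_sub_X_pow_succ_ne_zero i

lemma qfacNegPoly_ne_zero (k : ℕ) : qfacNegPoly k ≠ 0 := by
  refine prod_ne_zero_iff.mpr fun i _ h => ?_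
  simpa using congrArg (eval 0) h

/-- Gaussian binomial coefficients are polynomials. -/
lemma qfacPoly_mul_dvd (a b : ℕ) : qfacPoly a * qfacPoly b ∣ qfacPoly (a + b) := by
  induction a generalizing b with
  | zero => simp [qfacPoly]
  | succ a iha =>
    induction b with
    | zero => simp [qfacPoly]
    | succ b ihb =>
      obtain ⟨c, hc⟩ := iha (b + 1)
      obtain ⟨d, hd⟩ := ihb
      have hs : a + 1 + b = a + (b + 1) := by ring
      rw [hs] at hd
      refine ⟨c + X ^ (a + 1) * d, ?_⟩
      have hl : qfacPoly (a + 1 + (b + 1)) =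
          qfacPoly (a + (b + 1)) * (1 - X ^ (a + 1)) +
            qfacPoly (a + (b + 1)) * (X ^ (a + 1) * (1 - X ^ (b + 1))) := by
        rw [show a + 1 + (b + 1) = a + (b + 1) + 1 by ring, qfacPoly_succ]
        ring
      rw [hl]
      nth_rewrite 1 [hc]
      rw [hd, qfacPoly_succ a, qfacPoly_succ b]
      ring

lemma qfacPoly_mul_qfacNegPoly (k : ℕ) :
    qfacPoly k * qfacNegPoly k = ∏ i ∈ range k, (1 - X ^ (2 * (i + 1))) := by
  rw [qfacPoly, qfacNegPoly, ← prod_mul_distrib]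
  exact prod_congr rfl fun i _ => by ring

lemma prod_odd_mul_prod_even (m : ℕ) :
    (∏ i ∈ range (m + 1), (1 - X ^ (2 * i + 1) : ℚ[X])) *
      ∏ i ∈ range m, (1 - X ^ (2 * (i + 1))) = qfacPoly (2 * m + 1) := by
  induction m with
  | zero => simp [qfacPoly]
  | succ m ih =>
    rw [prod_range_succ, prod_range_succ (fun i => (1 - X ^ (2 * (i + 1)) : ℚ[X])),
      show 2 * (m + 1) + 1 = 2 * m + 1 + 1 + 1 by ring, qfacPoly_succ, qfacPoly_succ, ← ih]
    ring

lemma isCoprime_X_pow_sub_one_qfacNegPoly {n : ℕ} (hn : Odd n) (k : ℕ) :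
    IsCoprime (X ^ n - 1 : ℚ[X]) (qfacNegPoly k) := by
  refine IsCoprime.prod_right fun i _ => ?_
  obtain ⟨a, ha⟩ : (X ^ n - 1 : ℚ[X]) ∣ (X ^ n) ^ (i + 1) - 1 := sub_one_dvd_pow_sub_one _ _
  obtain ⟨b, hb⟩ : (X ^ (i + 1) + 1 : ℚ[X]) ∣ (X ^ (i + 1)) ^ n + 1 := by
    simpa using hn.add_dvd_pow_add_pow (X ^ (i + 1) : ℚ[X]) 1
  refine ⟨-C (1 / 2) * a, C (1 / 2) * b, ?_⟩
  have h2 : (C (1 / 2) * 2 : ℚ[X]) = 1 := by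
    rw [← C_ofNat, ← C_mul]
    norm_num
  have hab : (X ^ (i + 1) + 1) * b - (X ^ n - 1) * a = (2 : ℚ[X]) := by
    rw [← ha, ← hb]
    ring
  linear_combination C (1 / 2) * hab + h2

lemma IsPrimitiveRoot.aeval_qfacNegPoly {m : ℕ} {ζ : ℂ} (hζ : IsPrimitiveRoot ζ (m + 1))
    (hodd : Odd (m + 1)) : aeval ζ (qfacNegPoly m) = 1 := by
  have h := hζ.pow_add_pow_eq_prod_add_mul 1 1 hodd
  have hinj : Set.InjOn (fun i => ζ ^ i) (range (m + 1)) := fun i hi j hj hij =>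
    hζ.pow_inj (mem_range.mp hi) (mem_range.mp hj) hij
  have himg : nthRootsFinset (m + 1) (1 : ℂ) = (range (m + 1)).image (fun i => ζ ^ i) := by
    symm
    apply eq_of_subset_of_card_le
    · intro x hx
      obtain ⟨i, -, rfl⟩ := mem_image.mp hx
      rw [Polynomial.mem_nthRootsFinset m.succ_pos, ← pow_mul, mul_comm, pow_mul, hζ.pow_eq_one, one_pow]
    · rw [card_image_of_injOn hinj, hζ.card_nthRootsFinset, card_range]
  rw [himg, prod_image hinj, prod_range_succ'] at h
  simp only [qfacNegPoly, map_prod, map_add, map_one, map_pow, aeval_X]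
  norm_num at h
  exact h

lemma IsPrimitiveRoot.aeval_eq_one_of_qfacPoly_eq {m : ℕ} {ζ : ℂ}
    (hζ : IsPrimitiveRoot ζ (m + 1)) {c : ℚ[X]}
    (hc : qfacPoly (m + 1 + m) = qfacPoly (m + 1) * qfacPoly m * c) : aeval ζ c = 1 := by
  have hsplit : qfacPoly (m + 1 + m) =
      qfacPoly (m + 1) * ∏ i ∈ range m, (1 - X ^ (m + 1 + i + 1)) := prod_range_add _ _ _
  rw [hsplit, mul_assoc] at hc
  have h := congrArg (aeval ζ) (mul_left_cancel₀ (qfacPoly_ne_zero _) hc)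
  have hne : ∏ i ∈ range m, (1 - ζ ^ (i + 1)) ≠ 0 := by
    refine prod_ne_zero_iff.mpr fun i hi h0 => ?_
    exact hζ.pow_ne_one_of_pos_of_lt i.succ_ne_zero (by simpa using hi)
      (sub_eq_zero.mp h0).symm
  simp only [qfacPoly, map_mul, map_prod, map_sub, map_one, map_pow, aeval_X] at h
  simp only [add_assoc (m + 1), pow_add ζ (m + 1), hζ.pow_eq_one, one_mul] at h
  exact mul_left_cancel₀ hne (by rw [← h, mul_one])

lemma cyclotomic_dvd_sub_qfacNegPoly {m : ℕ} (hodd : Odd (m + 1)) {c : ℚ[X]}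
    (hc : qfacPoly (m + 1 + m) = qfacPoly (m + 1) * qfacPoly m * c) :
    cyclotomic (m + 1) ℚ ∣ c - qfacNegPoly m := by
  have hζ := Complex.isPrimitiveRoot_exp (m + 1) m.succ_ne_zero
  rw [cyclotomic_eq_minpoly_rat hζ m.succ_pos]
  apply minpoly.dvd
  rw [map_sub, hζ.aeval_eq_one_of_qfacPoly_eq hc, hζ.aeval_qfacNegPoly hodd, sub_self]

lemma dvd_num_of_eq_div {x : RatFunc ℚ} {p d r : ℚ[X]} (hd : d ≠ 0)
    (hx : x = algebraMap ℚ[X] (RatFunc ℚ) p / algebraMap ℚ[X] (RatFunc ℚ) d)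
    (hrp : r ∣ p) (hrd : IsCoprime r d) : r ∣ x.num := by
  refine hrd.dvd_of_dvd_mul_right ?_
  rw [(RatFunc.num_mul_eq_mul_denom_iff hd).mpr hx]
  exact hrp.mul_right _

theorem stmt_9 (n : ℕ) (hn : 1 < n) (hodd : Odd n) :
    ratCongr (qpoch q (q ^ 2) n / ((1 - q) * qpoch q q (n - 1))) (qint n)
      (qintPoly n * Polynomial.cyclotomic n ℚ) := by
  obtain ⟨m, rfl⟩ : ∃ m, n = m + 1 := ⟨n - 1, by omega⟩
  obtain ⟨c, hc⟩ := qfacPoly_mul_dvd (m + 1) m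
  set φ := algebraMap ℚ[X] (RatFunc ℚ) with hφ
  have hφ0 : ∀ {p : ℚ[X]}, p ≠ 0 → φ p ≠ 0 := fun hp => RatFunc.algebraMap_ne_zero hp
  have hq : φ X = q := RatFunc.algebraMap_X
  have hgeom : qintPoly (m + 1) * (1 - X) = 1 - X ^ (m + 1) := geom_sum_mul_neg X (m + 1)
  have hodd_prod : (∏ i ∈ range (m + 1), (1 - X ^ (2 * i + 1) : ℚ[X])) * qfacNegPoly m =
      qfacPoly m * (1 - X ^ (m + 1)) * c := by
    apply mul_left_cancel₀ (qfacPoly_ne_zero m)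
    have h := prod_odd_mul_prod_even m
    rw [← qfacPoly_mul_qfacNegPoly, show 2 * m + 1 = m + 1 + m by ring, hc, qfacPoly_succ] at h
    linear_combination h
  have hnum : qpoch q (q ^ 2) (m + 1) = φ (∏ i ∈ range (m + 1), (1 - X ^ (2 * i + 1))) := by
    simp only [qpoch, map_prod, map_sub, map_one, map_pow, hq]
    exact prod_congr rfl fun i _ => by ring
  have hden : qpoch q q m = φ (qfacPoly m) := by
    simp only [qpoch, qfacPoly, map_prod, map_sub, map_one, map_pow, hq]
    exact prod_congr rfl fun i _ => by ring
  have hqint : qint ((m + 1 : ℕ) : ℤ) = φ (1 - X ^ (m + 1)) / φ (1 - X) := by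
    simp only [qint, zpow_natCast, map_sub, map_one, map_pow, hq]
  have hX : φ (1 - X) ≠ 0 := hφ0 (by simpa using one_sub_X_pow_succ_ne_zero 0)
  have hP := hφ0 (qfacPoly_ne_zero m)
  have hD := hφ0 (qfacNegPoly_ne_zero m)
  refine dvd_num_of_eq_div (p := qintPoly (m + 1) * (c - qfacNegPoly m))
    (qfacNegPoly_ne_zero m) ?_ (mul_dvd_mul_left _ (cyclotomic_dvd_sub_qfacNegPoly hodd hc)) ?_
  · rw [Nat.add_sub_cancel, hnum, hden, hqint, show (1 - q : RatFunc ℚ) = φ (1 - X) by simp [hq],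
      ← hφ, map_mul, map_sub φ c]
    have h1 := congrArg φ hodd_prod
    have h2 := congrArg φ hgeom
    rw [map_mul, map_mul, map_mul] at h1
    rw [map_mul] at h2
    rw [← h2] at h1 ⊢
    field_simp
    linear_combination h1
  · have hcop := isCoprime_X_pow_sub_one_qfacNegPoly hodd m
    refine IsCoprime.mul_left (hcop.of_isCoprime_of_dvd_left ⟨X - 1, ?_⟩)
      (hcop.of_isCoprime_of_dvd_left (cyclotomic.dvd_X_pow_sub_one _ _))
    linear_combination hgeom
end

section
/- Let n > 1 be an odd integer. Then, modulo Φ_n(q), the following q-congruence of rational functions holds: [2n choose n]_q / (-q;q)_n ≡ 1. -/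
open Finset Polynomial

/-- If `x = A / B` with `A` and `B` taking the same nonzero value at a primitive `n`-th root of
unity, then `x ≡ 1` modulo the `n`-th cyclotomic polynomial. -/
theorem ratCongr_one_cyclotomic {n : ℕ} (hn : 0 < n) {ζ : ℂ} (hζ : IsPrimitiveRoot ζ n)
    {x : RatFunc ℚ} {A B : ℚ[X]}
    (hx : x * algebraMap ℚ[X] (RatFunc ℚ) B = algebraMap ℚ[X] (RatFunc ℚ) A)
    (hAB : aeval ζ A = aeval ζ B) (hB : aeval ζ B ≠ 0) :
    ratCongr x 1 (cyclotomic n ℚ) := by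
  rw [ratCongr, cyclotomic_eq_minpoly_rat hζ hn]
  apply minpoly.dvd
  have key : (x - 1).num * B = (A - B) * (x - 1).denom := by
    apply RatFunc.algebraMap_injective ℚ
    have hd : algebraMap ℚ[X] (RatFunc ℚ) (x - 1).denom ≠ 0 :=
      RatFunc.algebraMap_ne_zero (RatFunc.denom_ne_zero _)
    have h := RatFunc.num_div_denom (x - 1)
    rw [div_eq_iff hd] at h
    rw [map_mul, map_mul, map_sub, h, ← hx]
    ring
  have h := congrArg (aeval ζ) key
  rw [map_mul, map_mul, map_sub, hAB, sub_self, zero_mul] at h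
  exact (mul_eq_zero.mp h).resolve_right hB

theorem IsPrimitiveRoot.prod_one_add_pow_succ {n : ℕ} (hn : Odd n) {ζ : ℂ}
    (hζ : IsPrimitiveRoot ζ n) : ∏ i ∈ range n, (1 + ζ ^ (i + 1)) = 2 := by
  have h := congrArg (eval (-1)) (X_pow_sub_C_eq_prod hζ hn.pos hζ.pow_eq_one)
  simp only [eval_sub, eval_pow, eval_X, eval_C, eval_prod, hn.neg_one_pow, ← pow_succ] at h
  have h' : ∏ i ∈ range n, (-1 - ζ ^ (i + 1)) = -∏ i ∈ range n, (1 + ζ ^ (i + 1)) := by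
    rw [prod_congr rfl fun i _ => show -1 - ζ ^ (i + 1) = (-1) * (1 + ζ ^ (i + 1)) by ring,
      prod_mul_distrib, prod_const, card_range, hn.neg_one_pow, neg_one_mul]
  rw [h'] at h
  linear_combination h

theorem one_sub_q_pow_ne_zero {m : ℕ} (hm : m ≠ 0) : (1 : RatFunc ℚ) - q ^ m ≠ 0 := by
  have h : (X ^ m - 1 : ℚ[X]) ≠ 0 := (monic_X_pow_sub_C 1 hm).ne_zero
  have h' := RatFunc.algebraMap_ne_zero h
  simp only [map_sub, map_pow, RatFunc.algebraMap_X, map_one] at h'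
  rw [← neg_sub]
  exact neg_ne_zero.mpr h'

theorem one_add_q_pow_ne_zero {m : ℕ} (hm : m ≠ 0) : (1 : RatFunc ℚ) + q ^ m ≠ 0 := by
  intro h
  apply one_sub_q_pow_ne_zero (m := m * 2) (by omega)
  rw [pow_mul]
  linear_combination (1 - q ^ m) * h

theorem qpoch_q_q_ne_zero (n : ℕ) : qpoch q q n ≠ 0 :=
  prod_ne_zero_iff.mpr fun i _ => by
    rw [← pow_succ']
    exact one_sub_q_pow_ne_zero i.succ_ne_zero

theorem qpoch_neg_q_q_ne_zero (n : ℕ) : qpoch (-q) q n ≠ 0 :=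
  prod_ne_zero_iff.mpr fun i _ => by
    rw [neg_mul, sub_neg_eq_add, ← pow_succ']
    exact one_add_q_pow_ne_zero i.succ_ne_zero

/-- The central q-binomial coefficient with the common factor `1 - q^{m+1}` cancelled. -/
theorem qcb_succ_mul_prod (m : ℕ) :
    qcb (m + 1) * ∏ i ∈ range m, (1 - q ^ (i + 1)) =
      (1 + q ^ (m + 1)) * ∏ i ∈ range m, (1 - q ^ (m + 1 + (i + 1))) := by
  have hsplit : qpoch q q (2 * (m + 1)) = qpoch q q (m + 1) *
      ((∏ i ∈ range m, (1 - q ^ (m + 1 + (i + 1)))) * (1 - q ^ (2 * (m + 1)))) := by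
    rw [two_mul, qpoch, prod_range_add, ← qpoch,
      prod_range_succ (fun i => 1 - q * q ^ (m + 1 + i)) m]
    congr 2
    · exact prod_congr rfl fun i _ => by ring
    · ring
  have hlast : qpoch q q (m + 1) =
      (∏ i ∈ range m, (1 - q ^ (i + 1))) * (1 - q ^ (m + 1)) := by
    simp only [qpoch, prod_range_succ, ← pow_succ']
  have h0 := qpoch_q_q_ne_zero (m + 1)
  rw [qcb, hsplit, div_mul_eq_mul_div, div_eq_iff (pow_ne_zero 2 h0)]
  linear_combination (-(1 + q ^ (m + 1)) *
    (∏ i ∈ range m, (1 - q ^ (m + 1 + (i + 1)))) * qpoch q q (m + 1)) * hlast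

theorem stmt_11 (n : ℕ) (hn : 1 < n) (hodd : Odd n) :
    ratCongr (qcb n / qpoch (-q) q n) 1 (Polynomial.cyclotomic n ℚ) := by
  obtain ⟨m, rfl⟩ : ∃ m, n = m + 1 := ⟨n - 1, by omega⟩
  have hζ := Complex.isPrimitiveRoot_exp (m + 1) m.succ_ne_zero
  set ζ := Complex.exp (2 * Real.pi * Complex.I / (m + 1 : ℕ))
  refine ratCongr_one_cyclotomic m.succ_pos hζ
    (A := (1 + X ^ (m + 1)) * ∏ i ∈ range m, (1 - X ^ (m + 1 + (i + 1))))
    (B := (∏ i ∈ range (m + 1), (1 + X ^ (i + 1))) * ∏ i ∈ range m, (1 - X ^ (i + 1)))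
    ?_ ?_ ?_
  · have hM : qpoch (-q) q (m + 1) = ∏ i ∈ range (m + 1), (1 + q ^ (i + 1)) :=
      prod_congr rfl fun i _ => by ring
    have h0 := qpoch_neg_q_q_ne_zero (m + 1)
    simp only [map_mul, map_prod, map_add, map_sub, map_one, map_pow, RatFunc.algebraMap_X]
    change _ / _ * ((∏ i ∈ range (m + 1), (1 + q ^ (i + 1))) *
      ∏ i ∈ range m, (1 - q ^ (i + 1))) =
      (1 + q ^ (m + 1)) * ∏ i ∈ range m, (1 - q ^ (m + 1 + (i + 1)))
    rw [← hM, ← mul_assoc, div_mul_cancel₀ _ h0, qcb_succ_mul_prod]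
  · simp only [map_mul, map_prod, map_add, map_sub, map_one, map_pow, aeval_X,
      hζ.prod_one_add_pow_succ hodd, pow_add _ (m + 1), hζ.pow_eq_one, one_mul, one_add_one_eq_two]
  · simp only [map_mul, map_prod, map_add, map_sub, map_one, map_pow, aeval_X,
      hζ.prod_one_add_pow_succ hodd]
    refine mul_ne_zero two_ne_zero (prod_ne_zero_iff.mpr fun i hi => sub_ne_zero.mpr (Ne.symm ?_))
    exact hζ.pow_ne_one_of_pos_of_lt i.succ_ne_zero (by simpa using hi)
end

section
/- With F and G defined as below, for every integer m ≥ 1 and every integer k, the telescoping identity Σ_{n=0}^{m-1} F(n,k-1) - Σ_{n=0}^{m-1} F(n,k) = G(m,k) holds as an identity of rational functions in q. -/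
open Finset Polynomial

/-- The function `F(n,k)` of the q-WZ pair. -/
noncomputable def F (n : ℕ) (k : ℤ) : RatFunc ℚ :=
  qint (3 * n + 2 * k + 1) * qpoch q (q ^ 2) n * (qpoch (q ^ (2 * k + 1)) (q ^ 2) n) ^ 2 *
    q ^ (-((n : ℤ) * ((n : ℤ) + 1) / 2) - (2 * (n : ℤ) + 1) * k) /
    ((qpoch q q n) ^ 2 * qpoch (q ^ 2) (q ^ 2) n)

/-- The function `G(n,k)` of the q-WZ pair, with the convention `1/(q^2;q^2)_m = 0`
for negative `m` (so `G(0,k) = 0`). -/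
noncomputable def G (n : ℕ) (k : ℤ) : RatFunc ℚ :=
  if n = 0 then 0 else
    -((1 + q ^ ((n : ℤ) + 2 * k - 1)) * qpoch q (q ^ 2) n *
        (qpoch (q ^ (2 * k + 1)) (q ^ 2) (n - 1)) ^ 2 *
        q ^ (-((n : ℤ) * ((n : ℤ) - 1) / 2) - (2 * (n : ℤ) - 1) * k)) /
      ((1 - q) * (qpoch q q (n - 1)) ^ 2 * qpoch (q ^ 2) (q ^ 2) (n - 1))

theorem q_ne_zero : q ≠ 0 := RatFunc.X_ne_zero

theorem one_sub_q_pow_ne_zero_s13 {n : ℕ} (hn : n ≠ 0) : 1 - q ^ n ≠ 0 := by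
  intro h
  have h' : (algebraMap ℚ[X] (RatFunc ℚ)) (X ^ n) = algebraMap ℚ[X] (RatFunc ℚ) 1 := by
    rw [map_pow, map_one, RatFunc.algebraMap_X]
    exact (sub_eq_zero.mp h).symm
  have h'' := congrArg natDegree (RatFunc.algebraMap_injective ℚ h')
  rw [natDegree_X_pow, natDegree_one] at h''
  exact hn h''

theorem qpoch_succ (a b : RatFunc ℚ) (n : ℕ) :
    qpoch a b (n + 1) = qpoch a b n * (1 - a * b ^ n) :=
  Finset.prod_range_succ _ _

theorem qpoch_succ' (a b : RatFunc ℚ) (n : ℕ) :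
    qpoch a b (n + 1) = (1 - a) * qpoch (a * b) b n := by
  simp only [qpoch, Finset.prod_range_succ', pow_zero, mul_one, pow_succ']
  rw [mul_comm]
  simp only [mul_assoc]

theorem qpoch_q_pow_ne_zero {j : ℕ} (hj : j ≠ 0) (n : ℕ) : qpoch (q ^ j) (q ^ j) n ≠ 0 := by
  refine Finset.prod_ne_zero_iff.mpr fun i _ => ?_
  rw [← pow_succ', ← pow_mul]
  exact one_sub_q_pow_ne_zero_s13 (Nat.mul_ne_zero hj i.succ_ne_zero)

theorem q_zpow_eq {n : ℕ} {k e : ℤ} (i j l : ℕ) (h : e = i * n + j * k + l) :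
    q ^ e = (q ^ n) ^ i * (q ^ k) ^ j * q ^ l := by
  have hq := q_ne_zero
  rw [h, zpow_add₀ hq, zpow_add₀ hq, mul_comm (i : ℤ), mul_comm (j : ℤ), zpow_mul, zpow_mul]
  simp only [zpow_natCast]

theorem q_zpow_two_mul_add_one (k : ℤ) : q ^ (2 * k + 1) = (q ^ k) ^ 2 * q := by
  simpa using q_zpow_eq (n := 0) (k := k) 0 2 1 (by push_cast; ring)

theorem q_zpow_two_mul_sub_one (k : ℤ) : q ^ (2 * (k - 1) + 1) = (q ^ k) ^ 2 / q := by
  have hq := q_ne_zero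
  rw [q_zpow_two_mul_add_one, zpow_sub_one₀ hq]
  field_simp

theorem F_zero_sub (k : ℤ) : F 0 (k - 1) - F 0 k = G 1 k := by
  have hq := q_ne_zero
  have h1 : 1 - q ≠ 0 := by simpa using one_sub_q_pow_ne_zero_s13 one_ne_zero
  have e3 : q ^ (2 * k) = (q ^ k) ^ 2 := by
    simpa using q_zpow_eq (n := 0) (k := k) 0 2 0 (by push_cast; ring)
  have e4 : q ^ (1 - k) = q / q ^ k := by rw [zpow_sub₀ hq, zpow_one]
  have hk : q ^ k ≠ 0 := zpow_ne_zero _ hq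
  simp [F, G, qint, qpoch, q_zpow_two_mul_sub_one k, q_zpow_two_mul_add_one k, e3, e4]
  field_simp
  ring

theorem F_succ_sub (n : ℕ) (k : ℤ) :
    F (n + 1) (k - 1) - F (n + 1) k = G (n + 2) k - G (n + 1) k := by
  have hq := q_ne_zero
  have h1 : 1 - q ≠ 0 := by simpa using one_sub_q_pow_ne_zero_s13 one_ne_zero
  have hA : qpoch q q n ≠ 0 := by simpa using qpoch_q_pow_ne_zero one_ne_zero n
  have hB : qpoch (q ^ 2) (q ^ 2) n ≠ 0 := qpoch_q_pow_ne_zero two_ne_zero n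
  have hc : 1 - q * q ^ n ≠ 0 := by
    rw [← pow_succ']; exact one_sub_q_pow_ne_zero_s13 n.succ_ne_zero
  have hd : 1 - q ^ 2 * (q ^ n) ^ 2 ≠ 0 := by
    rw [← mul_pow, ← pow_succ', ← pow_mul]; exact one_sub_q_pow_ne_zero_s13 (by omega)
  have hpow : (q ^ 2) ^ n = (q ^ n) ^ 2 := by rw [← pow_mul, ← pow_mul, mul_comm]
  have e1 : q ^ (3 * ((n + 1 : ℕ) : ℤ) + 2 * (k - 1) + 1) = (q ^ n) ^ 3 * (q ^ k) ^ 2 * q ^ 2 :=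
    q_zpow_eq 3 2 2 (by push_cast; ring)
  have e2 : q ^ (3 * ((n + 1 : ℕ) : ℤ) + 2 * k + 1) = (q ^ n) ^ 3 * (q ^ k) ^ 2 * q ^ 4 :=
    q_zpow_eq 3 2 4 (by push_cast; ring)
  have e3 : q ^ (((n + 1 : ℕ) : ℤ) + 2 * k - 1) = (q ^ n) ^ 1 * (q ^ k) ^ 2 * q ^ 0 :=
    q_zpow_eq 1 2 0 (by push_cast; ring)
  have e4 : q ^ (((n + 2 : ℕ) : ℤ) + 2 * k - 1) = (q ^ n) ^ 1 * (q ^ k) ^ 2 * q ^ 1 :=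
    q_zpow_eq 1 2 1 (by push_cast; ring)
  obtain ⟨T, hT⟩ : ∃ T : ℤ, T = ((n + 1 : ℕ) : ℤ) * (((n + 1 : ℕ) : ℤ) - 1) / 2 := ⟨_, rfl⟩
  have hT1 : ((n + 1 : ℕ) : ℤ) * (((n + 1 : ℕ) : ℤ) + 1) / 2 = T + n + 1 := by
    rw [hT, show ((n + 1 : ℕ) : ℤ) * (((n + 1 : ℕ) : ℤ) + 1) =
      ((n + 1 : ℕ) : ℤ) * (((n + 1 : ℕ) : ℤ) - 1) + (n + 1) * 2 by push_cast; ring,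
      Int.add_mul_ediv_right _ _ two_ne_zero, add_assoc]
  have hT2 : ((n + 2 : ℕ) : ℤ) * (((n + 2 : ℕ) : ℤ) - 1) / 2 = T + n + 1 := by
    rw [← hT1]; congr 1; push_cast; ring
  obtain ⟨w, hw⟩ : ∃ w, w = q ^ (-(T + n + 1) - (2 * (n : ℤ) + 3) * k) := ⟨_, rfl⟩
  have w1 : q ^ (-(T + n + 1) - (2 * ((n + 1 : ℕ) : ℤ) + 1) * k) = w := by
    rw [hw]; congr 1
  have w2 : q ^ (-(T + n + 1) - (2 * ((n + 1 : ℕ) : ℤ) + 1) * (k - 1)) =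
      w * ((q ^ n) ^ 2 * (q ^ k) ^ 0 * q ^ 3) := by
    rw [hw, ← q_zpow_eq 2 0 3 rfl, ← zpow_add₀ hq]; congr 1; push_cast; ring
  have w3 : q ^ (-(T + n + 1) - (2 * ((n + 2 : ℕ) : ℤ) - 1) * k) = w := by
    rw [hw]; congr 1; push_cast; ring
  have w4 : q ^ (-T - (2 * ((n + 1 : ℕ) : ℤ) - 1) * k) =
      w * ((q ^ n) ^ 1 * (q ^ k) ^ 2 * q ^ 1) := by
    rw [hw, ← q_zpow_eq 1 2 1 rfl, ← zpow_add₀ hq]; congr 1; push_cast; ring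
  have p1 : qpoch ((q ^ k) ^ 2 / q) (q ^ 2) (n + 1) =
      (1 - (q ^ k) ^ 2 / q) * qpoch ((q ^ k) ^ 2 * q) (q ^ 2) n := by
    rw [qpoch_succ']
    congr 2
    field_simp
  simp only [F, G, qint, hT1, hT2, ← hT, w1, w2, w3, w4, e1, e2, e3, e4,
    q_zpow_two_mul_sub_one k, q_zpow_two_mul_add_one k, p1, if_neg (Nat.succ_ne_zero _),
    Nat.add_sub_cancel, show n + 2 - 1 = n + 1 from rfl]
  simp only [qpoch_succ, pow_succ (q ^ 2) n, hpow]
  generalize qpoch ((q ^ k) ^ 2 * q) (q ^ 2) n = P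
  generalize qpoch q (q ^ 2) n = R
  generalize qpoch q q n = A at *
  generalize qpoch (q ^ 2) (q ^ 2) n = B at *
  clear e1 e2 e3 e4 w1 w2 w3 w4 hw hT hT1 hT2 p1
  generalize q ^ n = a at *
  generalize q ^ k = b at *
  generalize q = x at *
  clear hpow
  rw [mul_comm] at hc hd
  field_simp
  ring

theorem stmt_13 (m : ℕ) (hm : 1 ≤ m) (k : ℤ) :
    (∑ n ∈ Finset.range m, F n (k - 1)) - (∑ n ∈ Finset.range m, F n k) = G m k := by
  induction m, hm using Nat.le_induction with
  | base => simpa using F_zero_sub k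
  | succ m hm ih =>
    obtain ⟨n, rfl⟩ := Nat.exists_eq_add_of_le' hm
    rw [Finset.sum_range_succ _ (n + 1), Finset.sum_range_succ _ (n + 1), add_sub_add_comm, ih,
      F_succ_sub, add_sub_cancel]
end

section
/- Let m > 1 be an odd integer and let G be defined as below. Then, modulo [m]^3·Φ_m(q), the following q-congruence of rational functions holds: G(m,0) ≡ -(1+q^{-1})·q^2·[m]^3. -/
open Finset Polynomial

/-- The polynomial `(X; X)_n = (1-X)(1-X^2)⋯(1-X^n)`. -/
noncomputable def qfact (n : ℕ) : ℚ[X] := ∏ i ∈ range n, (1 - X ^ (i + 1))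

/-- The polynomial `(-X; X)_n = (1+X)(1+X^2)⋯(1+X^n)`. -/
noncomputable def qplus (n : ℕ) : ℚ[X] := ∏ i ∈ range n, (1 + X ^ (i + 1))

/-- The polynomial `(X; X^2)_n = (1-X)(1-X^3)⋯(1-X^{2n-1})`. -/
noncomputable def qoddfact (n : ℕ) : ℚ[X] := ∏ i ∈ range n, (1 - X * (X ^ 2) ^ i)

/-- The Gaussian binomial coefficient `[a+b choose a]` as a polynomial. -/
noncomputable def gaussBinom : ℕ → ℕ → ℚ[X]
  | 0, _ => 1
  | _ + 1, 0 => 1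
  | a + 1, b + 1 => gaussBinom a (b + 1) + X ^ (a + 1) * gaussBinom (a + 1) b

lemma qfact_succ (n : ℕ) : qfact (n + 1) = qfact n * (1 - X ^ (n + 1)) :=
  prod_range_succ _ _

lemma gaussBinom_mul_qfact (a b : ℕ) :
    gaussBinom a b * qfact a * qfact b = qfact (a + b) := by
  induction a generalizing b with
  | zero => simp [gaussBinom, qfact]
  | succ a iha =>
    induction b with
    | zero => simp [gaussBinom, qfact]
    | succ b ihb =>
      have h₁ := iha (b + 1)
      have h₂ : qfact (a + 1 + (b + 1)) =
          qfact (a + (b + 1)) * (1 - X ^ (a + 1) * X ^ (b + 1)) := by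
        rw [show a + 1 + (b + 1) = a + (b + 1) + 1 by ring, qfact_succ, ← pow_add]
        congr 3
        ring
      rw [show a + 1 + b = a + (b + 1) by ring] at ihb
      rw [h₂, gaussBinom]
      rw [qfact_succ b] at h₁ ⊢
      rw [qfact_succ a] at ihb ⊢
      linear_combination (1 - X ^ (a + 1)) * h₁ + X ^ (a + 1) * (1 - X ^ (b + 1)) * ihb

lemma one_sub_X_pow_ne_zero {n : ℕ} (hn : n ≠ 0) : (1 - X ^ n : ℚ[X]) ≠ 0 := by
  rw [← neg_sub, neg_ne_zero]
  exact X_pow_sub_C_ne_zero (Nat.pos_of_ne_zero hn) 1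

lemma one_add_X_pow_ne_zero {n : ℕ} (hn : n ≠ 0) : (1 + X ^ n : ℚ[X]) ≠ 0 := by
  rw [add_comm]
  exact X_pow_add_C_ne_zero (Nat.pos_of_ne_zero hn) 1

lemma qfact_ne_zero (n : ℕ) : qfact n ≠ 0 :=
  prod_ne_zero_iff.2 fun i _ => one_sub_X_pow_ne_zero i.succ_ne_zero

lemma qplus_ne_zero (n : ℕ) : qplus n ≠ 0 :=
  prod_ne_zero_iff.2 fun i _ => one_add_X_pow_ne_zero i.succ_ne_zero

lemma qfact_mul_qplus (n : ℕ) :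
    qfact n * qplus n = ∏ i ∈ range n, (1 - X ^ 2 * (X ^ 2) ^ i) := by
  rw [qfact, qplus, ← prod_mul_distrib]
  exact prod_congr rfl fun i _ => by ring

lemma qoddfact_mul_qfact_mul_qplus (n : ℕ) :
    qoddfact n * (qfact n * qplus n) = qfact (2 * n) := by
  rw [qfact_mul_qplus, qoddfact]
  induction n with
  | zero => simp [qfact]
  | succ n ih =>
    rw [prod_range_succ, prod_range_succ, show 2 * (n + 1) = 2 * n + 1 + 1 by ring, qfact_succ,
      qfact_succ, ← ih]
    ring

lemma qintPoly_mul_one_sub (n : ℕ) : qintPoly n * (1 - X) = 1 - X ^ n :=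
  geom_sum_mul_neg _ _

lemma gaussBinom_mul_qfact_eq_prod (n : ℕ) :
    gaussBinom n (n + 1) * qfact n = ∏ i ∈ range n, (1 - X ^ (n + 1) * X ^ (i + 1)) := by
  have h : qfact (n + 1 + n) = qfact (n + 1) * ∏ i ∈ range n, (1 - X ^ (n + 1) * X ^ (i + 1)) := by
    rw [qfact, prod_range_add]
    congr 1
    exact prod_congr rfl fun i _ => by ring
  have h' := gaussBinom_mul_qfact n (n + 1)
  rw [show n + (n + 1) = n + 1 + n by ring, h] at h'
  exact mul_right_cancel₀ (qfact_ne_zero (n + 1)) (by rw [h']; ring)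

lemma qoddfact_mul_qplus_mul_qintPoly (n : ℕ) :
    qoddfact n * qplus n * qintPoly (2 * n + 1) =
      qfact n * qintPoly (n + 1) * gaussBinom n (n + 1) := by
  have h₁ := qoddfact_mul_qfact_mul_qplus n
  have h₂ := gaussBinom_mul_qfact n (n + 1)
  rw [show n + (n + 1) = 2 * n + 1 by ring, qfact_succ, qfact_succ, ← h₁,
    ← qintPoly_mul_one_sub, ← qintPoly_mul_one_sub] at h₂
  have hX : (1 - X : ℚ[X]) ≠ 0 := by simpa using one_sub_X_pow_ne_zero one_ne_zero
  refine mul_right_cancel₀ (mul_ne_zero (qfact_ne_zero n) hX) ?_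
  linear_combination -h₂

lemma isCoprime_qintPoly_mul_X (n : ℕ) :
    IsCoprime (qintPoly (n + 1)) (qintPoly (2 * n + 1) * X) := by
  have h₁ := qintPoly_mul_one_sub (n + 1)
  have h₂ : qintPoly (2 * n + 1) = qintPoly (n + 1) + X ^ (n + 1) * qintPoly n := by
    rw [qintPoly, show 2 * n + 1 = n + 1 + n by ring, sum_range_add, qintPoly, qintPoly, mul_sum]
    simp only [pow_add]
  have h₃ : qintPoly (n + 1) = 1 + X * qintPoly n := by
    rw [qintPoly, sum_range_succ', qintPoly, mul_sum, add_comm]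
    simp [pow_succ']
  refine ⟨X + X ^ (n + 1) - (X - 1), -1, ?_⟩
  rw [h₂]
  linear_combination X ^ (n + 1) * h₃ + h₁

lemma isCoprime_qintPoly_one_add_X_pow {m : ℕ} (hodd : Odd m) (i : ℕ) :
    IsCoprime (qintPoly m) (1 + X ^ i) := by
  have h₁ : qintPoly m ∣ X ^ (i * m) - 1 := by
    have h : qintPoly m ∣ X ^ m - 1 := ⟨X - 1, (geom_sum_mul _ _).symm⟩
    refine h.trans ?_
    rw [mul_comm, pow_mul]
    simpa using sub_dvd_pow_sub_pow (X ^ m : ℚ[X]) 1 i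
  have h₂ : (1 + X ^ i : ℚ[X]) ∣ 1 + X ^ (i * m) := by
    simpa [pow_mul] using hodd.add_dvd_pow_add_pow (1 : ℚ[X]) (X ^ i)
  obtain ⟨u, hu⟩ := h₁
  obtain ⟨v, hv⟩ := h₂
  have hC : (C (1 / 2) : ℚ[X]) * 2 = 1 := by
    rw [show (2 : ℚ[X]) = C 2 from rfl, ← C_mul]
    norm_num
  refine ⟨-(C (1 / 2) * u), C (1 / 2) * v, ?_⟩
  linear_combination C (1 / 2) * hu - C (1 / 2) * hv + hC

lemma isCoprime_qintPoly_qplus {m : ℕ} (hodd : Odd m) (n : ℕ) :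
    IsCoprime (qintPoly m) (qplus n) :=
  IsCoprime.prod_right fun i _ => isCoprime_qintPoly_one_add_X_pow hodd (i + 1)

lemma aeval_qfact {n : ℕ} {ζ : ℂ} (hζ : IsPrimitiveRoot ζ (n + 1)) :
    aeval ζ (qfact n) = n + 1 := by
  rw [← hζ.prod_one_sub_pow_eq_order]
  simp [qfact, map_prod]

lemma aeval_qplus {n : ℕ} (hodd : Odd (n + 1)) {ζ : ℂ} (hζ : IsPrimitiveRoot ζ (n + 1)) :
    aeval ζ (qplus n) = 1 := by
  have h₁ := aeval_qfact hζ
  have h₂ := (hζ.pow_of_coprime 2 hodd.coprime_two_left).prod_one_sub_pow_eq_order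
  have h₃ := congrArg (aeval ζ) (qfact_mul_qplus n)
  have h₄ : aeval ζ (∏ i ∈ range n, (1 - X ^ 2 * (X ^ 2) ^ i) : ℚ[X]) = (n + 1 : ℂ) := by
    rw [← h₂]
    simp [map_prod, pow_succ']
  rw [map_mul, h₁, h₄] at h₃
  exact mul_left_cancel₀ (Nat.cast_add_one_ne_zero n) (by rw [h₃, mul_one])

lemma aeval_gaussBinom {n : ℕ} {ζ : ℂ} (hζ : IsPrimitiveRoot ζ (n + 1)) :
    aeval ζ (gaussBinom n (n + 1)) = 1 := by
  have h₁ := aeval_qfact hζ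
  have h₂ := congrArg (aeval ζ) (gaussBinom_mul_qfact_eq_prod n)
  have h₃ : aeval ζ (∏ i ∈ range n, (1 - X ^ (n + 1) * X ^ (i + 1)) : ℚ[X]) = (n + 1 : ℂ) := by
    rw [← h₁]
    simp [qfact, map_prod, hζ.pow_eq_one]
  rw [map_mul, h₁, h₃] at h₂
  exact mul_right_cancel₀ (Nat.cast_add_one_ne_zero n) (by rw [h₂, one_mul])

lemma aeval_qintPoly_mul_self {n : ℕ} (hn : n ≠ 0) {ζ : ℂ} (hζ : IsPrimitiveRoot ζ (n + 1)) :
    aeval ζ (qintPoly (2 * n + 1)) * ζ = -1 := by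
  have h₁ := congrArg (aeval ζ) (qintPoly_mul_one_sub (2 * n + 1))
  simp only [map_mul, map_sub, map_one, aeval_X, map_pow] at h₁
  have h₂ : ζ ^ (2 * n + 1) * ζ = 1 := by
    rw [← pow_succ, show 2 * n + 1 + 1 = (n + 1) * 2 by ring, pow_mul, hζ.pow_eq_one, one_pow]
  have h₃ : 1 - ζ ≠ 0 := sub_ne_zero.2 (hζ.ne_one (by omega)).symm
  refine mul_right_cancel₀ h₃ ?_
  linear_combination ζ * h₁ - h₂

lemma cyclotomic_dvd_of_aeval_eq_zero {n : ℕ} (hn : 0 < n) {ζ : ℂ} (hζ : IsPrimitiveRoot ζ n)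
    {N : ℚ[X]} (h : aeval ζ N = 0) : cyclotomic n ℚ ∣ N := by
  rw [cyclotomic_eq_minpoly_rat hζ hn]
  exact minpoly.dvd ℚ ζ h

lemma cyclotomic_dvd_sub {n : ℕ} (hn : n ≠ 0) (hodd : Odd (n + 1)) {t : ℕ} (ht : n + 1 ∣ t) :
    cyclotomic (n + 1) ℚ ∣
      (X ^ 2 + X) * (qintPoly (2 * n + 1) ^ 2 * qplus n ^ 4 * X ^ t) -
        (1 + X ^ n) * gaussBinom n (n + 1) ^ 3 := by
  have hζ := Complex.isPrimitiveRoot_exp (n + 1) n.succ_ne_zero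
  refine cyclotomic_dvd_of_aeval_eq_zero n.succ_pos hζ ?_
  generalize Complex.exp _ = ζ at hζ
  have h₁ := aeval_qintPoly_mul_self hn hζ
  have h₂ : ζ ^ n * ζ = 1 := by rw [← pow_succ, hζ.pow_eq_one]
  have h₃ : ζ ^ t = 1 := (hζ.pow_eq_one_iff_dvd t).2 ht
  have h₄ : ζ ≠ 0 := hζ.ne_zero n.succ_ne_zero
  simp only [map_sub, map_mul, map_add, map_pow, map_one, aeval_X, aeval_qplus hodd hζ,
    aeval_gaussBinom hζ, h₃]
  refine mul_right_cancel₀ h₄ ?_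
  generalize aeval ζ (qintPoly (2 * n + 1)) = z at h₁
  linear_combination (ζ + 1) * (z * ζ - 1) * h₁ - h₂

lemma ratCongr_of_mul_eq {A B : RatFunc ℚ} {P N D : ℚ[X]} (hPD : IsCoprime P D)
    (hN : P ∣ N) (h : (A - B) * algebraMap ℚ[X] (RatFunc ℚ) D = algebraMap ℚ[X] (RatFunc ℚ) N) :
    ratCongr A B P := by
  refine hPD.dvd_of_dvd_mul_right ?_
  have hd : algebraMap ℚ[X] (RatFunc ℚ) (A - B).denom ≠ 0 :=
    RatFunc.algebraMap_ne_zero (RatFunc.denom_ne_zero _)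
  have hnum : (A - B).num * D = N * (A - B).denom := by
    apply RatFunc.algebraMap_injective ℚ
    rw [map_mul, map_mul, ← h]
    conv_rhs => rw [← RatFunc.num_div_denom (A - B)]
    field_simp
    simp
  rw [hnum]
  exact hN.mul_right _

lemma qpoch_q_q (n : ℕ) : qpoch q q n = algebraMap ℚ[X] (RatFunc ℚ) (qfact n) := by
  simp [qpoch, qfact, q, pow_succ']

lemma qpoch_q_sq (n : ℕ) : qpoch q (q ^ 2) n = algebraMap ℚ[X] (RatFunc ℚ) (qoddfact n) := by
  simp [qpoch, qoddfact, q]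

lemma qpoch_sq_sq (n : ℕ) :
    qpoch (q ^ 2) (q ^ 2) n = algebraMap ℚ[X] (RatFunc ℚ) (qfact n * qplus n) := by
  rw [qfact_mul_qplus]
  simp [qpoch, q]

lemma one_sub_q_ne_zero : 1 - q ≠ 0 := by
  have h := RatFunc.algebraMap_ne_zero (one_sub_X_pow_ne_zero one_ne_zero)
  simpa [q] using h

lemma qint_natCast (n : ℕ) : qint n = algebraMap ℚ[X] (RatFunc ℚ) (qintPoly n) := by
  rw [qint, div_eq_iff one_sub_q_ne_zero]
  have h := congrArg (algebraMap ℚ[X] (RatFunc ℚ)) (qintPoly_mul_one_sub n)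
  simpa [q] using h.symm

lemma G_succ_zero_mul {n t : ℕ} (ht : (n + 1) * n = 2 * t) :
    G (n + 1) 0 * algebraMap ℚ[X] (RatFunc ℚ) (qintPoly (2 * n + 1) ^ 2 * qplus n ^ 4 * X ^ t) =
      -algebraMap ℚ[X] (RatFunc ℚ)
        ((1 + X ^ n) * qintPoly (n + 1) ^ 3 * gaussBinom n (n + 1) ^ 3) := by
  have hq : q ≠ 0 := RatFunc.X_ne_zero
  have hq₁ := one_sub_q_ne_zero
  have hP := RatFunc.algebraMap_ne_zero (qfact_ne_zero n)
  have hE := RatFunc.algebraMap_ne_zero (qplus_ne_zero n)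
  have hexp : -(((n + 1 : ℕ) : ℤ) * (((n + 1 : ℕ) : ℤ) - 1) / 2) -
      (2 * ((n + 1 : ℕ) : ℤ) - 1) * 0 = -(t : ℤ) := by
    have : ((n + 1 : ℕ) : ℤ) * (((n + 1 : ℕ) : ℤ) - 1) = 2 * t := by
      push_cast
      rw [add_sub_cancel_right]
      exact_mod_cast ht
    rw [this]
    simp
  have hexp' : ((n + 1 : ℕ) : ℤ) + 2 * 0 - 1 = n := by simp
  have hodd : qpoch q (q ^ 2) (n + 1) =
      algebraMap ℚ[X] (RatFunc ℚ) (qoddfact n * qintPoly (2 * n + 1)) * (1 - q) := by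
    have h := congrArg (algebraMap ℚ[X] (RatFunc ℚ)) (qintPoly_mul_one_sub (2 * n + 1))
    simp only [map_mul, map_sub, map_one, map_pow, RatFunc.algebraMap_X] at h
    rw [qpoch, prod_range_succ, ← qpoch, qpoch_q_sq, map_mul, mul_assoc]
    simp only [q]
    rw [h]
    ring
  have key := congrArg (algebraMap ℚ[X] (RatFunc ℚ)) (qoddfact_mul_qplus_mul_qintPoly n)
  rw [G, if_neg n.succ_ne_zero, hexp, hexp', hodd, Nat.add_sub_cancel, mul_zero, zero_add, zpow_one,
    qpoch_q_q, qpoch_q_sq, qpoch_sq_sq, zpow_neg, zpow_natCast, zpow_natCast]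
  simp only [map_mul, map_add, map_one, map_pow, RatFunc.algebraMap_X] at key ⊢
  change _ = -((1 + q ^ n) * _ * _)
  change _ * (_ * _ * q ^ t) = _
  generalize algebraMap ℚ[X] (RatFunc ℚ) (qfact n) = P at *
  generalize algebraMap ℚ[X] (RatFunc ℚ) (qplus n) = E at *
  generalize algebraMap ℚ[X] (RatFunc ℚ) (qoddfact n) = S at *
  generalize algebraMap ℚ[X] (RatFunc ℚ) (qintPoly (2 * n + 1)) = Z at *
  generalize algebraMap ℚ[X] (RatFunc ℚ) (qintPoly (n + 1)) = M at *
  generalize algebraMap ℚ[X] (RatFunc ℚ) (gaussBinom n (n + 1)) = B at *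
  have key₃ : S ^ 3 * E ^ 3 * Z ^ 3 = P ^ 3 * M ^ 3 * B ^ 3 := by
    rw [← mul_pow, ← mul_pow, key, mul_pow, mul_pow]
  field_simp
  linear_combination -(1 + q ^ n) * key₃

theorem stmt_15 (m : ℕ) (hm : 1 < m) (hodd : Odd m) :
    ratCongr (G m 0) (-(1 + q ^ (-1 : ℤ)) * q ^ 2 * (qint m) ^ 3)
      ((qintPoly m) ^ 3 * Polynomial.cyclotomic m ℚ) := by
  obtain ⟨k, rfl⟩ := hodd
  have hk : 2 * k ≠ 0 := by omega
  have hodd : Odd (2 * k + 1) := odd_two_mul_add_one k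
  set n := 2 * k with hn
  set t := (n + 1) * k with ht
  have hD : IsCoprime (qintPoly (n + 1))
      (qintPoly (2 * n + 1) ^ 2 * qplus n ^ 4 * X ^ t) := by
    have h := isCoprime_qintPoly_mul_X n
    exact ((h.of_mul_right_left.pow_right).mul_right
      (isCoprime_qintPoly_qplus hodd n).pow_right).mul_right h.of_mul_right_right.pow_right
  have hcyc : cyclotomic (n + 1) ℚ ∣ qintPoly (n + 1) := by
    rw [qintPoly, ← prod_cyclotomic_eq_geom_sum n.succ_pos]
    exact dvd_prod_of_mem _ (by simp [hk])
  refine ratCongr_of_mul_eq (hD.pow_left.mul_left (hD.of_isCoprime_of_dvd_left hcyc))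
    (mul_dvd_mul_left _ (cyclotomic_dvd_sub hk hodd (Dvd.intro k rfl))) ?_
  have hG := G_succ_zero_mul (n := n) (t := t) (by rw [ht, hn]; ring)
  have hq : q ≠ 0 := RatFunc.X_ne_zero
  have hB : -(1 + q ^ (-1 : ℤ)) * q ^ 2 * qint ((n + 1 : ℕ) : ℤ) ^ 3 =
      -algebraMap ℚ[X] (RatFunc ℚ) ((X ^ 2 + X) * qintPoly (n + 1) ^ 3) := by
    rw [qint_natCast]
    simp only [map_mul, map_add, map_pow, RatFunc.algebraMap_X]
    change _ = -((q ^ 2 + q) * _)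
    field_simp
  rw [sub_mul, hG, hB, ← map_neg, ← map_neg, ← map_mul, ← map_sub]
  congr 1
  ring
end
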